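/- Let G be a finite group with ω(G) ≤ 4. Then either G is solvable or G is isomorphic to the alternating group A₅. -/

import Mathlib

open scoped MatrixGroups

/-- The number of orbits of the natural action of the automorphism group `Aut G`
on the group `G`. -/
noncomputable def omegaAut (G : Type*) [Group G] : ℕ :=
  Nat.card (MulAction.orbitRel.Quotient (MulAut G) G)

theorem sum_eq_zero_or_forall_eq_of_isIntegral_average {ι : Type*} [Fintype ι] [Nonempty ι]
    {n : ℕ} (hn : 0 < n) (f : ι → ℂ) (hf : ∀ i, f i ^ n = 1)
    (hintegral : IsIntegral ℤ ((∑ i, f i) / Fintype.card ι)) :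
    ∑ i, f i = 0 ∨ ∃ c, ∀ i, f i = c := by
  classical
  by_cases h0 : ∑ i, f i = 0
  · exact Or.inl h0
  right
  have hcard : (0 : ℝ) < Fintype.card ι := by exact_mod_cast Fintype.card_pos
  have hcard' : (Fintype.card ι : ℂ) ≠ 0 := by exact_mod_cast hcard.ne'
  have hnorm : ∀ z : ℂ, z ^ n = 1 → ‖z‖ = 1 := fun z hz =>
    Complex.norm_eq_one_of_pow_eq_one hz hn.ne'
  let K := IntermediateField.adjoin ℚ (Set.range f)
  have : FiniteDimensional ℚ K := by
    apply IntermediateField.finiteDimensional_adjoin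
    rintro x ⟨i, rfl⟩
    exact ⟨Polynomial.X ^ n - 1, Polynomial.monic_X_pow_sub_C 1 hn.ne', by simp [hf]⟩
  have : NumberField K := { to_charZero := inferInstance, to_finiteDimensional := this }
  let g : ι → K := fun i => ⟨f i, IntermediateField.subset_adjoin _ _ ⟨i, rfl⟩⟩
  have hg : ∀ i, g i ^ n = 1 := fun i => Subtype.ext (by simpa [g] using hf i)
  set a : K := (∑ i, g i) / Fintype.card ι with ha
  have hac : (a : ℂ) = (∑ i, f i) / Fintype.card ι := by
    simp [ha, g]
  have ha0 : a ≠ 0 := by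
    intro h
    rw [h] at hac
    have := hac.symm
    simp [h0, hcard'] at this
  obtain ⟨m, hm, hpow⟩ := NumberField.Embeddings.pow_eq_one_of_norm_le_one K ℂ ha0
    (IntermediateField.coe_isIntegral_iff.mp (hac ▸ hintegral)) (by
      intro φ
      rw [ha, map_div₀, map_sum, map_natCast, norm_div, Complex.norm_natCast, div_le_one hcard]
      refine (norm_sum_le _ _).trans ?_
      rw [Finset.sum_congr rfl (fun i _ => hnorm (φ (g i)) (by rw [← map_pow, hg, map_one]))]
      simp)
  have hα : ‖(a : ℂ)‖ = 1 := Complex.norm_eq_one_of_pow_eq_one (n := m)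
    (by exact_mod_cast congrArg (algebraMap K ℂ) hpow) hm.ne'
  set α : ℂ := (a : ℂ) with hαdef
  refine ⟨α, fun i => ?_⟩
  have hαα : α * star α = 1 := by
    have := Complex.mul_conj' α
    rw [hα] at this
    simpa using this
  have hle : ∀ i ∈ Finset.univ, (f i * star α).re ≤ 1 := fun i _ => by
    refine (Complex.re_le_norm _).trans ?_
    rw [norm_mul, norm_star, hα, hnorm _ (hf i), one_mul]
  have hsum : ∑ i, (f i * star α).re = ∑ i : ι, (1 : ℝ) := by
    rw [← Complex.re_sum, ← Finset.sum_mul]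
    have : ∑ i, f i = Fintype.card ι * α := by
      rw [hac]; field_simp
    rw [this, mul_assoc, hαα]
    simp
  have h1 := (Finset.sum_eq_sum_iff_of_le hle).mp hsum i (Finset.mem_univ i)
  have h2 : ‖f i * star α‖ = 1 := by rw [norm_mul, norm_star, hα, hnorm _ (hf i), one_mul]
  have h3 : f i * star α = 1 := by
    have := Complex.re_eq_norm.mp (h1.trans h2.symm)
    apply Complex.ext
    · simpa using h1
    · simpa using this.2.symm
  calc f i = f i * (α * star α) := by rw [hαα, mul_one]
    _ = (f i * star α) * α := by ring
    _ = α := by rw [h3, one_mul]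

theorem Matrix.pow_eq_one_of_mem_roots_charpoly {d n : ℕ} {M : Matrix (Fin d) (Fin d) ℂ}
    (hM : M ^ n = 1) {z : ℂ} (hz : z ∈ M.charpoly.roots) : z ^ n = 1 := by
  have h1 : z ∈ spectrum ℂ M :=
    Matrix.mem_spectrum_iff_isRoot_charpoly.mpr (Polynomial.isRoot_of_mem_roots hz)
  have h2 := spectrum.pow_mem_pow M n h1
  rw [hM] at h2
  rcases isEmpty_or_nonempty (Fin d) with h | h
  · have : Subsingleton (Matrix (Fin d) (Fin d) ℂ) := inferInstance
    simp at h2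
  · simpa [spectrum.one_eq] using h2

theorem Matrix.isIntegral_trace_of_pow_eq_one {d n : ℕ} (hn : 0 < n)
    {M : Matrix (Fin d) (Fin d) ℂ} (hM : M ^ n = 1) : IsIntegral ℤ M.trace := by
  rw [Matrix.trace_eq_sum_roots_charpoly]
  refine IsIntegral.multiset_sum fun z hz => ?_
  refine IsIntegral.of_pow hn ?_
  rw [Matrix.pow_eq_one_of_mem_roots_charpoly hM hz]
  exact isIntegral_one

theorem Matrix.trace_eq_zero_or_eq_smul_one {d n : ℕ} [NeZero d] (hn : 0 < n)
    {M : Matrix (Fin d) (Fin d) ℂ} (hM : M ^ n = 1) (hintegral : IsIntegral ℤ (M.trace / d)) :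
    M.trace = 0 ∨ ∃ c : ℂ, M = c • 1 := by
  classical
  set s := M.charpoly.roots with hs
  have hcard : s.card = d := by
    rw [hs, ← (IsAlgClosed.splits M.charpoly).natDegree_eq_card_roots,
      Matrix.charpoly_natDegree_eq_dim]
    simp
  have hcard' : Fintype.card s = d := by simpa using hcard
  have : Nonempty s := Fintype.card_pos_iff.mp
    (by rw [hcard']; exact Nat.pos_of_ne_zero (NeZero.ne d))
  have htr : M.trace = ∑ i : s, (i : ℂ) := by
    rw [Matrix.trace_eq_sum_roots_charpoly, ← hs]
    conv_lhs => rw [← Multiset.map_univ_coe s]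
    rfl
  rw [htr, ← hcard'] at hintegral
  rcases sum_eq_zero_or_forall_eq_of_isIntegral_average hn (fun i : s => (i : ℂ))
    (fun i => Matrix.pow_eq_one_of_mem_roots_charpoly hM (Multiset.coe_mem))
    hintegral with h | ⟨c, hc⟩
  · exact Or.inl (htr.trans h)
  right
  refine ⟨c, ?_⟩
  have hrep : s = Multiset.replicate d c := by
    rw [Multiset.eq_replicate]
    refine ⟨hcard, fun z hz => ?_⟩
    exact hc (Multiset.mkToType s z ⟨0, Multiset.count_pos.mpr hz⟩)
  have hchar : M.charpoly = (Polynomial.X - Polynomial.C c) ^ d := by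
    rw [(IsAlgClosed.splits M.charpoly).eq_prod_roots_of_monic (Matrix.charpoly_monic M),
      ← hs, hrep]
    simp
  have hd1 : minpoly ℂ M ∣ (Polynomial.X - Polynomial.C c) ^ d :=
    hchar ▸ Matrix.minpoly_dvd_charpoly M
  have hd2 : minpoly ℂ M ∣ Polynomial.X ^ n - 1 := minpoly.dvd _ _ (by simp [hM])
  have hsep : Squarefree (Polynomial.X ^ n - 1 : Polynomial ℂ) :=
    (Polynomial.separable_X_pow_sub_C (1 : ℂ) (by exact_mod_cast hn.ne') one_ne_zero).squarefree
  have hdvd : minpoly ℂ M ∣ Polynomial.X - Polynomial.C c :=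
    (Squarefree.dvd_pow_iff_dvd (hsep.squarefree_of_dvd hd2) (NeZero.ne d)).mp hd1
  have h := Polynomial.aeval_eq_zero_of_dvd_aeval_eq_zero hdvd (minpoly.aeval ℂ M)
  rw [map_sub, Polynomial.aeval_X, Polynomial.aeval_C, sub_eq_zero] at h
  rw [h, Algebra.algebraMap_eq_smul_one]

theorem LinearMap.trace_mulLeft_pi_matrix {n : ℕ} {d : Fin n → ℕ}
    (x : Π i, Matrix (Fin (d i)) (Fin (d i)) ℂ) :
    LinearMap.trace ℂ _ (LinearMap.mulLeft ℂ x) = ∑ i, (d i : ℂ) * (x i).trace := by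
  classical
  let b := Pi.basis fun i => Matrix.stdBasis ℂ (Fin (d i)) (Fin (d i))
  rw [LinearMap.trace_eq_matrix_trace ℂ b, Matrix.trace, Fintype.sum_sigma]
  refine Finset.sum_congr rfl fun i _ => ?_
  have hdiag : ∀ a c : Fin (d i),
      (LinearMap.toMatrix b b (LinearMap.mulLeft ℂ x)).diag ⟨i, (a, c)⟩ = x i a a := by
    intro a c
    rw [Matrix.diag_apply, LinearMap.toMatrix_apply]
    simp [b, Pi.basis_repr, Matrix.stdBasis, Matrix.mul_apply, Pi.single_apply, ite_apply]
  rw [Fintype.sum_prod_type]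
  simp only [hdiag]
  simp [Matrix.trace, Finset.mul_sum]

theorem MonoidAlgebra.trace_mulLeft_single_of_ne_one {G : Type*} [Group G] [Finite G]
    {g : G} (hg : g ≠ 1) :
    LinearMap.trace ℂ _ (LinearMap.mulLeft ℂ (MonoidAlgebra.single g (1 : ℂ))) = 0 := by
  classical
  have := Fintype.ofFinite G
  rw [LinearMap.trace_eq_matrix_trace ℂ (MonoidAlgebra.basis G ℂ), Matrix.trace]
  refine Finset.sum_eq_zero fun h _ => ?_
  rw [Matrix.diag_apply, LinearMap.toMatrix_apply]
  simp [MonoidAlgebra.basis, MonoidAlgebra.coeff_single, hg]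

theorem Matrix.exists_eq_smul_one_of_forall_commute {d : ℕ} {M : Matrix (Fin d) (Fin d) ℂ}
    (hM : ∀ N, Commute N M) : ∃ c : ℂ, M = c • 1 := by
  obtain ⟨c, hc⟩ := Matrix.mem_range_scalar_of_commute_single (M := M) fun _ => by
    intros; exact hM _
  exact ⟨c, by rw [← hc, Matrix.smul_one_eq_diagonal]; rfl⟩

theorem not_isIntegral_inv_prime {p : ℕ} (hp : p.Prime) : ¬ IsIntegral ℤ ((p : ℂ)⁻¹) := by
  intro h
  have h1 : IsIntegral ℤ ((p : ℚ)⁻¹) := by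
    rw [← isIntegral_algebraMap_iff (B := ℂ) (algebraMap ℚ ℂ).injective]
    simpa using h
  obtain ⟨m, hm⟩ := IsIntegrallyClosed.isIntegral_iff.mp h1
  have hp0 : (p : ℚ) ≠ 0 := by exact_mod_cast hp.ne_zero
  have h2 : (m : ℚ) * p = 1 := by
    have : (m : ℚ) = (p : ℚ)⁻¹ := by simpa using hm
    rw [this, inv_mul_cancel₀ hp0]
  have h3 : m * (p : ℤ) = 1 := by exact_mod_cast h2
  have := Int.isUnit_iff.mp (IsUnit.of_mul_eq_one_right _ h3)
  have := hp.one_lt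
  omega

/-- The `i`-th component of an algebra homomorphism from the complex group algebra to a product of
matrix algebras, as a matrix representation of the group. -/
noncomputable def componentRep {G : Type*} [Group G] {n : ℕ} {d : Fin n → ℕ}
    (φ : MonoidAlgebra ℂ G ≃ₐ[ℂ] Π i, Matrix (Fin (d i)) (Fin (d i)) ℂ) (i : Fin n) :
    G →* Matrix (Fin (d i)) (Fin (d i)) ℂ where
  toFun g := φ (MonoidAlgebra.single g 1) i
  map_one' := by
    rw [← MonoidAlgebra.one_def, map_one, Pi.one_apply]
  map_mul' g h := by
    rw [← Pi.mul_apply, ← map_mul, MonoidAlgebra.single_mul_single, one_mul]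

section ComponentRep

variable {G : Type*} [Group G] {n : ℕ} {d : Fin n → ℕ}
  (φ : MonoidAlgebra ℂ G ≃ₐ[ℂ] Π i, Matrix (Fin (d i)) (Fin (d i)) ℂ)

theorem componentRep_apply (i : Fin n) (g : G) :
    componentRep φ i g = φ (MonoidAlgebra.single g 1) i := rfl

theorem component_eq_sum [Fintype G] (i : Fin n) (x : MonoidAlgebra ℂ G) :
    φ x i = ∑ g, x.coeff g • componentRep φ i g := by
  have hx : x = ∑ g, x.coeff g • MonoidAlgebra.single g (1 : ℂ) := by
    ext h
    simp [MonoidAlgebra.coeff_single]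
  conv_lhs => rw [hx]
  rw [map_sum, Finset.sum_apply]
  simp only [map_smul, Pi.smul_apply, componentRep_apply]

theorem exists_component_eq_smul_one {i : Fin n} {x : MonoidAlgebra ℂ G}
    (hx : ∀ y, Commute y x) : ∃ c : ℂ, φ x i = c • 1 := by
  classical
  refine Matrix.exists_eq_smul_one_of_forall_commute fun N => ?_
  have h := (hx (φ.symm (Pi.single i N))).map φ
  rw [AlgEquiv.apply_symm_apply] at h
  simpa using h.map (Pi.evalMonoidHom _ i)

theorem exists_unique_trivial_component [Finite G] [∀ i, NeZero (d i)] :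
    ∃ i, (∀ g, componentRep φ i g = 1) ∧ ∀ j, (∀ g, componentRep φ j g = 1) → j = i := by
  classical
  have := Fintype.ofFinite G
  set e : MonoidAlgebra ℂ G := ∑ g, MonoidAlgebra.single g 1 with he
  have hmul : ∀ g, MonoidAlgebra.single g (1 : ℂ) * e = e := by
    intro g
    rw [he, Finset.mul_sum]
    simp only [MonoidAlgebra.single_mul_single, one_mul]
    exact Fintype.sum_equiv (Equiv.mulLeft g) _ _ fun _ => rfl
  have hmul' : ∀ g, e * MonoidAlgebra.single g (1 : ℂ) = e := by
    intro g
    rw [he, Finset.sum_mul]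
    simp only [MonoidAlgebra.single_mul_single, one_mul]
    exact Fintype.sum_equiv (Equiv.mulRight g) _ _ fun _ => rfl
  have hcomm : ∀ y, Commute y e := by
    intro y
    induction y using MonoidAlgebra.induction_on with
    | of g => exact (hmul g).trans (hmul' g).symm
    | add a b ha hb => exact ha.add_left hb
    | smul r a ha => exact ha.smul_left r
  have hexists : ∃ i, ∀ g, componentRep φ i g = 1 := by
    by_contra! hno
    have he0 : e ≠ 0 := by
      intro h
      have := congrArg (fun x => x.coeff 1) h
      simp [he, MonoidAlgebra.coeff_single, Finsupp.single_apply] at this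
    apply he0
    rw [← map_eq_zero_iff φ φ.injective]
    funext i
    obtain ⟨g, hg⟩ := hno i
    obtain ⟨c, hc⟩ := exists_component_eq_smul_one φ (i := i) hcomm
    have h1 : componentRep φ i g * φ e i = φ e i := by
      rw [componentRep_apply, ← Pi.mul_apply, ← map_mul, hmul]
    rw [hc] at h1 ⊢
    rw [mul_smul_comm, mul_one] at h1
    by_contra hc0
    have hc0 : c ≠ 0 := by rintro rfl; simp at hc0
    exact hg (smul_right_injective _ hc0 h1)
  obtain ⟨i, hi⟩ := hexists
  refine ⟨i, hi, fun j hj => ?_⟩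
  by_contra hij
  have hcard : (Fintype.card G : ℂ) ≠ 0 := by exact_mod_cast Fintype.card_ne_zero
  obtain ⟨x, hx⟩ := φ.surjective (Pi.single i 1)
  have h1 : φ x i = 1 := by rw [hx]; simp
  have h2 : φ x j = 0 := by rw [hx]; simp [hij]
  rw [component_eq_sum] at h1 h2
  simp only [hi, hj, ← Finset.sum_smul] at h1 h2
  rw [smul_eq_zero] at h2
  rcases h2 with h2 | h2
  · rw [h2, zero_smul] at h1
    exact zero_ne_one h1
  · exact one_ne_zero h2

theorem eq_one_of_component_trivial [Finite G] [∀ i, NeZero (d i)] {i : Fin n}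
    (hi : ∀ g, componentRep φ i g = 1) : d i = 1 := by
  classical
  have := Fintype.ofFinite G
  by_contra hne
  have hpos := Nat.pos_of_ne_zero (NeZero.ne (d i))
  have h0 : (⟨0, by omega⟩ : Fin (d i)) ≠ ⟨1, by omega⟩ := by simp
  obtain ⟨x, hx⟩ := φ.surjective (Pi.single i (Matrix.single ⟨0, by omega⟩ ⟨1, by omega⟩ 1))
  have h1 := congrFun hx i
  rw [component_eq_sum] at h1
  simp only [hi, ← Finset.sum_smul, Pi.single_eq_same] at h1
  have h2 := congrFun (congrFun h1 ⟨0, by omega⟩) ⟨1, by omega⟩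
  simp at h2

theorem isIntegral_card_mul_trace_div [Finite G] [∀ i, NeZero (d i)] (i : Fin n) (g : G) :
    IsIntegral ℤ (Nat.card (MulAction.orbit (ConjAct G) g) * (componentRep φ i g).trace / d i) := by
  classical
  have := Fintype.ofFinite G
  have hd : (d i : ℂ) ≠ 0 := by exact_mod_cast NeZero.ne (d i)
  set C : Finset G := (MulAction.orbit (ConjAct G) g).toFinset with hC
  have hCmem : ∀ h, h ∈ C ↔ IsConj g h := by
    intro h
    rw [hC, Set.mem_toFinset, ConjAct.mem_orbit_conjAct, isConj_comm]
  have hcard : Nat.card (MulAction.orbit (ConjAct G) g) = C.card := by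
    rw [hC, Set.toFinset_card, Nat.card_eq_fintype_card]
  set K : MonoidAlgebra ℂ G := ∑ h ∈ C, MonoidAlgebra.single h 1 with hK
  have hcomm : ∀ y, Commute y K := by
    intro y
    induction y using MonoidAlgebra.induction_on with
    | of x =>
      change MonoidAlgebra.single x (1 : ℂ) * K = K * MonoidAlgebra.single x (1 : ℂ)
      rw [hK, Finset.mul_sum, Finset.sum_mul]
      simp only [MonoidAlgebra.single_mul_single, one_mul]
      refine Finset.sum_bij (fun h _ => x * h * x⁻¹) ?_ ?_ ?_ ?_
      · intro h hh
        rw [hCmem] at hh ⊢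
        exact hh.trans (isConj_iff.mpr ⟨x, rfl⟩)
      · intro a _ b _ hab
        simpa using hab
      · intro b hb
        refine ⟨x⁻¹ * b * x, ?_, by group⟩
        rw [hCmem] at hb ⊢
        exact hb.trans (isConj_iff.mpr ⟨x⁻¹, by group⟩)
      · intro h _
        simp
    | add a b ha hb => exact ha.add_left hb
    | smul r a ha => exact ha.smul_left r
  obtain ⟨c, hc⟩ := exists_component_eq_smul_one φ (i := i) hcomm
  have hKi : φ K i = ∑ h ∈ C, componentRep φ i h := by
    simp [hK, componentRep_apply]
  have htr : (C.card : ℂ) * (componentRep φ i g).trace = c * d i := by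
    have h1 : (φ K i).trace = c * d i := by rw [hc]; simp
    rw [← h1, hKi, Matrix.trace_sum, ← nsmul_eq_mul, ← Finset.sum_const]
    refine Finset.sum_congr rfl fun h hh => ?_
    obtain ⟨x, hx⟩ := isConj_iff.mp ((hCmem h).mp hh)
    rw [← hx, map_mul, Matrix.trace_mul_comm, ← map_mul]
    congr 2
    group
  rw [hcard, htr, mul_div_cancel_right₀ _ hd]
  have hintegral : IsIntegral ℤ (φ K i) := by
    let F : MonoidAlgebra ℤ G →ₐ[ℤ] Matrix (Fin (d i)) (Fin (d i)) ℂ :=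
      MonoidAlgebra.lift ℤ _ G (componentRep φ i)
    have hF : φ K i = F (∑ h ∈ C, MonoidAlgebra.single h 1) := by
      simp [hKi, F, MonoidAlgebra.lift_single]
    rw [hF]
    have : Module.Finite ℤ (MonoidAlgebra ℤ G) := Module.Finite.of_basis (MonoidAlgebra.basis G ℤ)
    exact (IsIntegral.of_finite ℤ _).map F
  rw [hc, ← Algebra.algebraMap_eq_smul_one] at hintegral
  exact (isIntegral_algebraMap_iff (algebraMap ℂ (Matrix (Fin (d i)) (Fin (d i)) ℂ)).injective).mp
    hintegral

end ComponentRep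

theorem mem_center_of_card_conj_eq_prime_pow {G : Type*} [Group G] [Finite G] [IsSimpleGroup G]
    {p k : ℕ} (hp : p.Prime) {g : G}
    (hg : Nat.card (MulAction.orbit (ConjAct G) g) = p ^ k) : g ∈ Subgroup.center G := by
  classical
  by_contra hcen
  have hg1 : g ≠ 1 := by rintro rfl; exact hcen (one_mem _)
  obtain ⟨n, d, hd, ⟨φ⟩⟩ :=
    IsSemisimpleRing.exists_algEquiv_pi_matrix_of_isAlgClosed ℂ (MonoidAlgebra ℂ G)
  obtain ⟨i₀, hi₀, huniq⟩ := exists_unique_trivial_component φ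
  have hpow : ∀ i, (componentRep φ i g) ^ Nat.card G = 1 := fun i => by
    rw [← map_pow, pow_card_eq_one', map_one]
  have hdich : ∀ i, i ≠ i₀ → p ∣ d i ∨ (componentRep φ i g).trace = 0 := by
    intro i hi
    by_contra! hcon
    obtain ⟨hpd, htr⟩ := hcon
    have hd0 : (d i : ℂ) ≠ 0 := by exact_mod_cast NeZero.ne (d i)
    have hcop : IsCoprime ((p ^ k : ℕ) : ℤ) (d i : ℤ) :=
      Nat.isCoprime_iff_coprime.mpr (((Nat.Prime.coprime_iff_not_dvd hp).mpr hpd).pow_left k)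
    obtain ⟨u, v, huv⟩ := hcop
    have h1 := isIntegral_card_mul_trace_div φ i g
    have h2 : IsIntegral ℤ (componentRep φ i g).trace :=
      Matrix.isIntegral_trace_of_pow_eq_one Nat.card_pos (hpow i)
    have huv' : (u : ℂ) * (p ^ k : ℕ) + v * d i = 1 := by exact_mod_cast huv
    have h3 : IsIntegral ℤ ((componentRep φ i g).trace / d i) := by
      have h4 : (componentRep φ i g).trace / d i =
          u * (Nat.card (MulAction.orbit (ConjAct G) g) * (componentRep φ i g).trace / d i) +
            v * (componentRep φ i g).trace := by
        rw [hg]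
        field_simp
        linear_combination -huv'
      rw [h4]
      exact ((isIntegral_algebraMap (x := u)).mul h1).add ((isIntegral_algebraMap (x := v)).mul h2)
    rcases Matrix.trace_eq_zero_or_eq_smul_one Nat.card_pos (hpow i) h3 with h | ⟨c, hc⟩
    · exact htr h
    · rcases (inferInstance : (componentRep φ i).ker.Normal).eq_bot_or_eq_top with hk | hk
      · refine hcen (Subgroup.mem_center_iff.mpr fun h => ?_)
        have h5 : h * g * (g * h)⁻¹ ∈ (componentRep φ i).ker := by
          rw [MonoidHom.mem_ker, map_mul]
          have h6 : componentRep φ i (h * g) = componentRep φ i (g * h) := by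
            rw [map_mul, map_mul, hc, mul_smul_comm, smul_mul_assoc, one_mul, mul_one]
          rw [h6, ← map_mul, mul_inv_cancel, map_one]
        rw [hk, Subgroup.mem_bot, mul_inv_eq_one] at h5
        exact h5
      · refine hi (huniq i fun h => ?_)
        rw [← MonoidHom.mem_ker, hk]
        trivial
  have htrace : ∑ i, (d i : ℂ) * (componentRep φ i g).trace = 0 := by
    have h1 := LinearMap.trace_conj' (LinearMap.mulLeft ℂ (MonoidAlgebra.single g (1 : ℂ)))
      φ.toLinearEquiv
    rw [MonoidAlgebra.trace_mulLeft_single_of_ne_one hg1] at h1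
    have h2 : φ.toLinearEquiv.conj (LinearMap.mulLeft ℂ (MonoidAlgebra.single g (1 : ℂ))) =
        LinearMap.mulLeft ℂ (φ (MonoidAlgebra.single g 1)) := by
      apply LinearMap.ext
      intro x
      rw [LinearEquiv.conj_apply_apply]
      simp
    rw [h2, LinearMap.trace_mulLeft_pi_matrix] at h1
    exact h1
  have htr1 : (d i₀ : ℂ) * (componentRep φ i₀ g).trace = 1 := by
    rw [hi₀, Matrix.trace_one, Fintype.card_fin, eq_one_of_component_trivial φ hi₀, Nat.cast_one,
      one_mul]
  rw [← Finset.add_sum_erase _ _ (Finset.mem_univ i₀), htr1] at htrace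
  have hp0 : (p : ℂ) ≠ 0 := by exact_mod_cast hp.ne_zero
  refine not_isIntegral_inv_prime hp ?_
  have h1 : (p : ℂ)⁻¹ =
      -∑ i ∈ Finset.univ.erase i₀, (d i : ℂ) * (componentRep φ i g).trace / p := by
    rw [← Finset.sum_div, eq_neg_of_add_eq_zero_right htrace]
    field_simp
  rw [h1]
  refine (IsIntegral.sum _ fun i hi => ?_).neg
  rcases hdich i (Finset.ne_of_mem_erase hi) with ⟨m, hm⟩ | h
  · have h2 : (d i : ℂ) * (componentRep φ i g).trace / p = m * (componentRep φ i g).trace := by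
      have h3 : (d i : ℂ) = p * m := by exact_mod_cast hm
      rw [h3]
      field_simp
    rw [h2]
    exact (isIntegral_algebraMap (x := (m : ℤ))).mul
      (Matrix.isIntegral_trace_of_pow_eq_one Nat.card_pos (hpow i))
  · rw [h, mul_zero, zero_div]
    exact isIntegral_zero

theorem Sylow.exists_mem_ne_one_le_centralizer {G : Type*} [Group G] [Finite G] {p : ℕ}
    [Fact p.Prime] (P : Sylow p G) (hp : p ∣ Nat.card G) :
    ∃ z ∈ P, z ≠ 1 ∧ (P : Subgroup G) ≤ Subgroup.centralizer {z} := by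
  have hne : Nontrivial P := by
    rw [← Finite.one_lt_card_iff_nontrivial]
    exact (Fact.out : p.Prime).one_lt.trans_le
      (Nat.le_of_dvd Nat.card_pos (P.dvd_card_of_dvd_card hp))
  have hcne : Nontrivial (Subgroup.center P) := P.2.center_nontrivial
  obtain ⟨⟨z, hz⟩, hz1⟩ := exists_ne (1 : Subgroup.center P)
  refine ⟨z, z.2, fun h => hz1 (by ext; simpa using h), fun y hy => ?_⟩
  rw [Subgroup.mem_centralizer_singleton_iff]
  exact congrArg Subtype.val (Subgroup.mem_center_iff.mp hz ⟨y, hy⟩)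

theorem card_orbit_conjAct {G : Type*} [Group G] [Finite G] (g : G) :
    Nat.card (MulAction.orbit (ConjAct G) g) = (Subgroup.centralizer {g}).index := by
  have h1 := Subgroup.card_mul_index (Subgroup.centralizer {g})
  rw [Subgroup.nat_card_centralizer_nat_card_stabilizer] at h1
  have h2 := Subgroup.card_mul_index (MulAction.stabilizer (ConjAct G) g)
  rw [MulAction.index_stabilizer] at h2
  have h3 : Nat.card (ConjAct G) = Nat.card G := rfl
  rw [h3, ← h1] at h2
  have h4 : 0 < Nat.card (MulAction.stabilizer (ConjAct G) g) := by
    rw [← Subgroup.nat_card_centralizer_nat_card_stabilizer]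
    exact Nat.card_pos
  exact Nat.eq_of_mul_eq_mul_left h4 h2

theorem IsSimpleGroup.isSolvable_of_card_primeFactors_le_two {G : Type*} [Group G] [Finite G]
    [IsSimpleGroup G] (h : (Nat.card G).primeFactors.card ≤ 2) : Group.IsSolvable G := by
  have hcard : 1 < Nat.card G := Finite.one_lt_card
  set p := (Nat.card G).minFac with hp
  have hpp : Fact p.Prime := ⟨Nat.minFac_prime hcard.ne'⟩
  have hpd : p ∣ Nat.card G := Nat.minFac_dvd _
  obtain ⟨P⟩ : Nonempty (Sylow p G) := inferInstance
  obtain ⟨z, hzP, hz1, hz⟩ := P.exists_mem_ne_one_le_centralizer hpd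
  have hpi : ¬ p ∣ (Subgroup.centralizer {z}).index := fun hd =>
    P.not_dvd_index (hd.trans (Subgroup.index_dvd_of_le hz))
  set c := (Subgroup.centralizer {z}).index with hc
  have hc0 : c ≠ 0 := Subgroup.FiniteIndex.index_ne_zero
  have hcc : c.primeFactors.card ≤ 1 := by
    have hsub : c.primeFactors ⊆ (Nat.card G).primeFactors.erase p := by
      intro q hq
      have hq' := Nat.dvd_of_mem_primeFactors hq
      refine Finset.mem_erase.mpr ⟨?_, Nat.mem_primeFactors.mpr
        ⟨Nat.prime_of_mem_primeFactors hq, hq'.trans (Subgroup.index_dvd_card _), by omega⟩⟩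
      rintro rfl
      exact hpi hq'
    have := Finset.card_le_card hsub
    rw [Finset.card_erase_of_mem (Nat.mem_primeFactors.mpr ⟨hpp.out, hpd, by omega⟩)] at this
    omega
  obtain ⟨q, k, hq, hqk⟩ : ∃ q k, q.Prime ∧ c = q ^ k := by
    by_cases h1 : c = 1
    · exact ⟨2, 0, Nat.prime_two, h1⟩
    · refine ⟨c.minFac, _, Nat.minFac_prime h1, Nat.eq_prime_pow_of_unique_prime_dvd hc0 ?_⟩
      intro r hr hrd
      exact Finset.card_le_one.mp hcc _ (Nat.mem_primeFactors.mpr ⟨hr, hrd, hc0⟩) _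
        (Nat.mem_primeFactors.mpr ⟨Nat.minFac_prime h1, Nat.minFac_dvd _, hc0⟩)
  have hzc : z ∈ Subgroup.center G :=
    mem_center_of_card_conj_eq_prime_pow hq (by rw [card_orbit_conjAct, ← hc, hqk])
  have htop : Subgroup.center G = ⊤ := by
    refine ((inferInstance : (Subgroup.center G).Normal).eq_bot_or_eq_top).resolve_left fun hb => ?_
    rw [hb] at hzc
    exact hz1 hzc
  refine Group.isSolvable_of_comm fun a b => ?_
  have ha : b ∈ Subgroup.center G := by rw [htop]; trivial
  exact Subgroup.mem_center_iff.mp ha a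

theorem Group.isSolvable_of_card_primeFactors_le_two {G : Type*} [Group G] [Finite G]
    (h : (Nat.card G).primeFactors.card ≤ 2) : Group.IsSolvable G := by
  induction hn : Nat.card G using Nat.strong_induction_on generalizing G with
  | _ n ih =>
    by_cases hN : ∃ N : Subgroup G, N.Normal ∧ N ≠ ⊥ ∧ N ≠ ⊤
    · obtain ⟨N, hNn, hbot, htop⟩ := hN
      have hmul := Subgroup.card_mul_index N
      have hN1 : 1 < Nat.card N := by
        rw [Finite.one_lt_card_iff_nontrivial, Subgroup.nontrivial_iff_ne_bot]; exact hbot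
      have hN2 : 1 < N.index := by
        have h1 : N.index ≠ 1 := by rwa [Ne, Subgroup.index_eq_one]
        have h0 : N.index ≠ 0 := Subgroup.FiniteIndex.index_ne_zero
        omega
      have hG : Nat.card G ≠ 0 := Nat.card_pos.ne'
      have hle : ∀ m, m ∣ Nat.card G → m.primeFactors.card ≤ 2 := fun m hm =>
        (Finset.card_le_card (Nat.primeFactors_mono hm hG)).trans h
      rw [Group.isSolvable_iff_subgroup_quotient N]
      refine ⟨ih (Nat.card N) ?_ (hle _ (Subgroup.card_subgroup_dvd_card N)) rfl,
        ih N.index ?_ (hle _ (Subgroup.index_dvd_card N)) rfl⟩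
      · rw [← hn, ← hmul]; exact lt_mul_of_one_lt_right (by omega) hN2
      · rw [← hn, ← hmul]; exact lt_mul_of_one_lt_left (by omega) hN1
    · push Not at hN
      cases subsingleton_or_nontrivial G with
      | inl _ => infer_instance
      | inr _ =>
        have : IsSimpleGroup G :=
          ⟨fun N hNn => or_iff_not_imp_left.mpr fun hb => hN N hNn hb⟩
        exact IsSimpleGroup.isSolvable_of_card_primeFactors_le_two h

section FixedPointFree

variable {E V : Type*} [Group E] [CommGroup V] (θ : E →* MulAut V)

theorem prod_subgroup_eq_one_of_fixedPointFree [Fintype E]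
    (hfree : ∀ e v, θ e v = v → e = 1 ∨ v = 1) (T : Subgroup E) [DecidablePred (· ∈ T)]
    (hT : T ≠ ⊥) (v : V) : ∏ y ∈ Finset.univ.filter (· ∈ T), θ y v = 1 := by
  obtain ⟨a, haT, ha⟩ := T.bot_or_exists_ne_one.resolve_left hT
  refine (hfree a _ ?_).resolve_left ha
  rw [map_prod]
  refine Finset.prod_bij (fun y _ => a * y) ?_ ?_ ?_ ?_
  · intro y hy
    simp only [Finset.mem_filter, Finset.mem_univ, true_and] at hy ⊢
    exact T.mul_mem haT hy
  · intro y _ z _ h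
    exact mul_left_cancel h
  · intro y hy
    simp only [Finset.mem_filter, Finset.mem_univ, true_and] at hy
    exact ⟨a⁻¹ * y, by simpa using T.mul_mem (T.inv_mem haT) hy, by simp⟩
  · intro y _
    rw [map_mul, MulAut.mul_apply]

theorem pow_card_eq_one_of_fixedPointFree [Finite E]
    (hfree : ∀ e v, θ e v = v → e = 1 ∨ v = 1) {s : ℕ} (hs : s.Prime) (T : Subgroup E)
    (hT : T ≠ ⊥) (hcard : Nat.card E = s * Nat.card T) (hord : ∀ y ∉ T, orderOf y = s) (v : V) :
    v ^ Nat.card T = 1 := by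
  classical
  have := Fintype.ofFinite E
  have := Fintype.ofFinite (Subgroup E)
  set A : Finset E := Finset.univ.filter (· ∉ T) with hA
  have htop : ∏ y, θ y v = 1 := by
    have h := prod_subgroup_eq_one_of_fixedPointFree θ hfree ⊤ (fun h => hT (by
      rw [eq_bot_iff, ← h]; exact le_top)) v
    simpa using h
  have hprodA : ∏ y ∈ A, θ y v = 1 := by
    rw [← Finset.prod_filter_mul_prod_filter_not Finset.univ (· ∈ T),
      prod_subgroup_eq_one_of_fixedPointFree θ hfree T hT, one_mul] at htop
    exact htop
  set B : Finset (Subgroup E) := A.image Subgroup.zpowers with hB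
  have hmaps : ∀ y ∈ A, Subgroup.zpowers y ∈ B := fun y hy => Finset.mem_image_of_mem _ hy
  have hfib : ∀ C ∈ B, Nat.card C = s ∧ C ≠ ⊥ ∧
      A.filter (fun y => Subgroup.zpowers y = C) = (Finset.univ.filter (· ∈ C)).erase 1 := by
    intro C hC
    obtain ⟨y, hy, rfl⟩ := Finset.mem_image.mp hC
    have hyT : y ∉ T := by simpa [hA] using hy
    have hcardC : Nat.card (Subgroup.zpowers y) = s := by rw [Nat.card_zpowers, hord y hyT]
    have hzp : ∀ w ∈ Subgroup.zpowers y, w ≠ 1 → Subgroup.zpowers w = Subgroup.zpowers y := by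
      intro w hw hw1
      have hle : Subgroup.zpowers w ≤ Subgroup.zpowers y := by simpa using hw
      refine Subgroup.eq_of_le_of_card_ge hle ?_
      have hdvd := Subgroup.card_dvd_of_le hle
      rw [hcardC] at hdvd ⊢
      rcases (Nat.dvd_prime hs).mp hdvd with h | h
      · rw [Nat.card_zpowers, orderOf_eq_one_iff] at h
        exact absurd h hw1
      · exact h.ge
    refine ⟨hcardC, fun h => ?_, ?_⟩
    · rw [Subgroup.zpowers_eq_bot] at h
      exact hyT (h ▸ one_mem T)
    · ext w
      simp only [hA, Finset.mem_filter, Finset.mem_univ, true_and, Finset.mem_erase]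
      constructor
      · rintro ⟨hwT, hw⟩
        exact ⟨fun h => hwT (h ▸ one_mem T), hw ▸ Subgroup.mem_zpowers w⟩
      · rintro ⟨hw1, hw⟩
        have h := hzp w hw hw1
        refine ⟨fun hwT => hyT ?_, h⟩
        have hle : Subgroup.zpowers w ≤ T := by simpa using hwT
        exact hle (h ▸ Subgroup.mem_zpowers y)
  have hcardfib : ∀ C ∈ B, (A.filter (fun y => Subgroup.zpowers y = C)).card = s - 1 := by
    intro C hC
    obtain ⟨h1, -, h3⟩ := hfib C hC
    rw [h3, Finset.card_erase_of_mem (by simp [one_mem]), ← h1, Nat.card_eq_fintype_card,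
      Fintype.card_subtype]
  have hprodfib : ∀ C ∈ B, ∏ y ∈ A.filter (fun y => Subgroup.zpowers y = C), θ y v = v⁻¹ := by
    intro C hC
    obtain ⟨-, h2, h3⟩ := hfib C hC
    have h4 := prod_subgroup_eq_one_of_fixedPointFree θ hfree C h2 v
    rw [← Finset.mul_prod_erase _ _ (a := 1) (by simp [one_mem]), map_one, MulAut.one_apply] at h4
    rw [h3]
    exact eq_inv_of_mul_eq_one_right h4
  have hBcard : B.card = Nat.card T := by
    have h1 := Finset.card_eq_sum_card_fiberwise hmaps
    rw [Finset.sum_congr rfl hcardfib, Finset.sum_const, smul_eq_mul] at h1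
    have h2 := Finset.card_filter_add_card_filter_not (s := (Finset.univ : Finset E)) (· ∈ T)
    rw [← hA, Finset.card_univ, ← Nat.card_eq_fintype_card, hcard, ← Fintype.card_subtype,
      ← Nat.card_eq_fintype_card, h1] at h2
    obtain ⟨m, rfl⟩ : ∃ m, s = m + 2 := ⟨s - 2, by have := hs.two_le; omega⟩
    have h3 : m + 2 - 1 = m + 1 := rfl
    rw [h3] at h2
    have h4 : B.card * (m + 1) = Nat.card T * (m + 1) := by
      have h5 : Nat.card ↥T = Nat.card {x // x ∈ T} := rfl
      nlinarith
    exact Nat.eq_of_mul_eq_mul_right (by omega) h4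
  rw [← Finset.prod_fiberwise_of_maps_to hmaps, Finset.prod_congr rfl hprodfib,
    Finset.prod_const, hBcard, inv_pow, inv_eq_one] at hprodA
  exact hprodA

theorem card_eq_one_or_prime_of_fixedPointFree [Finite E]
    (hfree : ∀ e v, θ e v = v → e = 1 ∨ v = 1) (hord : ∀ e : E, e ≠ 1 → (orderOf e).Prime)
    (hcard : (Nat.card E).primeFactors.card ≤ 2) {p : ℕ}
    (hpE : ¬ p ∣ Nat.card E) {v : V} (hv : orderOf v = p) :
    Nat.card E = 1 ∨ (Nat.card E).Prime := by
  have key : ∀ (F : Subgroup E) (s : ℕ) (T : Subgroup F), s.Prime → T ≠ ⊥ →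
      Nat.card F = s * Nat.card T → (∀ y ∉ T, orderOf y = s) → False := by
    intro F s T hs hT hF hy
    have h1 := pow_card_eq_one_of_fixedPointFree (θ.comp F.subtype)
      (fun e w h => (hfree e w h).imp_left fun h => by ext; exact h) hs T hT hF hy v
    rw [← orderOf_dvd_iff_pow_eq_one, hv] at h1
    exact hpE ((h1.trans (Dvd.intro_left s hF.symm)).trans (Subgroup.card_subgroup_dvd_card F))
  have hsq : Squarefree (Nat.card E) := by
    rw [Nat.squarefree_iff_prime_squarefree]
    intro s hs hsd
    have : Fact s.Prime := ⟨hs⟩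
    obtain ⟨F, hF⟩ := Sylow.exists_subgroup_card_pow_prime s (n := 2) (by rwa [pow_two])
    obtain ⟨T, hT⟩ := Sylow.exists_subgroup_card_pow_prime (G := F) s (n := 1) (by
      rw [hF]; exact pow_dvd_pow _ (by norm_num))
    rw [pow_one] at hT
    refine key F s T hs ?_ (by rw [hF, hT, pow_two]) ?_
    · rintro rfl
      rw [Subgroup.card_bot] at hT
      exact hs.one_lt.ne hT
    · intro y hy
      have hy1 : y ≠ 1 := fun h => hy (h ▸ one_mem T)
      have hyp : (orderOf y).Prime := by
        rw [← Subgroup.orderOf_coe]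
        exact hord _ (by simpa using hy1)
      have hd : orderOf y ∣ s ^ 2 := hF ▸ orderOf_dvd_natCard y
      exact (Nat.prime_dvd_prime_iff_eq hyp hs).mp (hyp.dvd_of_dvd_pow hd)
  have hprod := Nat.prod_primeFactors_of_squarefree hsq
  have hE0 : Nat.card E ≠ 0 := Nat.card_pos.ne'
  have hcases : (Nat.card E).primeFactors.card = 0 ∨ (Nat.card E).primeFactors.card = 1 ∨
    (Nat.card E).primeFactors.card = 2 := by omega
  rcases hcases with h | h | h
  · rw [Finset.card_eq_zero] at h
    rw [h, Finset.prod_empty] at hprod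
    exact .inl hprod.symm
  · obtain ⟨s, hs⟩ := Finset.card_eq_one.mp h
    have hsp : s.Prime := Nat.prime_of_mem_primeFactors (n := Nat.card E) (by simp [hs])
    rw [hs, Finset.prod_singleton] at hprod
    exact .inr (hprod ▸ hsp)
  · exfalso
    obtain ⟨s, t, hs, ht, hst, hE⟩ : ∃ s t : ℕ, s.Prime ∧ t.Prime ∧ s < t ∧
        Nat.card E = s * t := by
      obtain ⟨s, t, hst, hs⟩ := Finset.card_eq_two.mp h
      have hsp : s.Prime := Nat.prime_of_mem_primeFactors (n := Nat.card E) (by simp [hs])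
      have htp : t.Prime := Nat.prime_of_mem_primeFactors (n := Nat.card E) (by simp [hs])
      rw [hs, Finset.prod_pair hst] at hprod
      rcases hst.lt_or_gt with h | h
      · exact ⟨s, t, hsp, htp, h, hprod.symm⟩
      · exact ⟨t, s, htp, hsp, h, by rw [← hprod, mul_comm]⟩
    have : Fact t.Prime := ⟨ht⟩
    have hF : Nat.card (⊤ : Subgroup E) = s * t := by rw [Subgroup.card_top, hE]
    obtain ⟨T, hT⟩ := Sylow.exists_subgroup_card_pow_prime (G := (⊤ : Subgroup E)) t (n := 1) (by
      rw [hF, pow_one]; exact dvd_mul_left _ _)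
    rw [pow_one] at hT
    have hidx : T.index = s := by
      have := T.card_mul_index
      rw [hT, hF, mul_comm s] at this
      exact Nat.eq_of_mul_eq_mul_left ht.pos this
    have hmin : (Nat.card (⊤ : Subgroup E)).minFac = s := by
      rw [hF]
      have h1 : (s * t).minFac ≤ s := Nat.minFac_le_of_dvd hs.two_le (dvd_mul_right _ _)
      have h1p : (s * t).minFac.Prime := Nat.minFac_prime (by
        have := Nat.mul_le_mul hs.two_le ht.two_le; omega)
      rcases h1p.dvd_mul.mp (Nat.minFac_dvd (s * t)) with h2 | h2
      · exact (Nat.prime_dvd_prime_iff_eq h1p hs).mp h2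
      · have := (Nat.prime_dvd_prime_iff_eq h1p ht).mp h2
        omega
    have hTn : T.Normal := Subgroup.normal_of_index_eq_minFac_card (by rw [hidx, hmin])
    refine key ⊤ s T hs ?_ (by rw [hF, hT]) ?_
    · rintro rfl
      rw [Subgroup.card_bot] at hT
      exact ht.one_lt.ne hT
    · intro y hy
      have hy1 : y ≠ 1 := fun h => hy (h ▸ one_mem T)
      have hyp : (orderOf y).Prime := by
        rw [← Subgroup.orderOf_coe]
        exact hord _ (by simpa using hy1)
      have hd : orderOf y ∣ s * t := hF ▸ orderOf_dvd_natCard y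
      rcases hyp.dvd_mul.mp hd with h2 | h2
      · exact (Nat.prime_dvd_prime_iff_eq hyp hs).mp h2
      · exfalso
        have h3 := (Nat.prime_dvd_prime_iff_eq hyp ht).mp h2
        refine hy ((QuotientGroup.eq_one_iff (N := T) y).mp ?_)
        rw [← orderOf_eq_one_iff]
        have h4 : orderOf (y : (⊤ : Subgroup E) ⧸ T) ∣ t :=
          h3 ▸ orderOf_map_dvd (QuotientGroup.mk' T) y
        have h5 : orderOf (y : (⊤ : Subgroup E) ⧸ T) ∣ s := hidx ▸ orderOf_dvd_natCard _
        exact Nat.dvd_one.mp (((Nat.coprime_primes hs ht).mpr hst.ne) ▸ Nat.dvd_gcd h5 h4)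

theorem card_dvd_card_sub_one_of_fixedPointFree [Finite E] [Finite V]
    (hfree : ∀ e v, θ e v = v → e = 1 ∨ v = 1) : Nat.card E ∣ Nat.card V - 1 := by
  classical
  have := Fintype.ofFinite V
  have := Fintype.ofFinite E
  let _ : MulAction E {v : V // v ≠ 1} :=
    { smul := fun e v => ⟨θ e v, by simpa using v.2⟩
      one_smul := fun v => Subtype.ext (by change θ 1 (v : V) = v; simp)
      mul_smul := fun a b v => Subtype.ext (by change θ (a * b) (v : V) = θ a (θ b v); simp) }
  have hstab : ∀ v : {v : V // v ≠ 1}, MulAction.stabilizer E v = ⊥ := by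
    intro v
    rw [eq_bot_iff]
    intro e he
    rw [MulAction.mem_stabilizer_iff] at he
    exact (hfree e v (congrArg Subtype.val he)).resolve_right v.2
  have hcard : Nat.card V - 1 = Nat.card {v : V // v ≠ 1} := by
    rw [Nat.card_eq_fintype_card, Nat.card_eq_fintype_card, Fintype.card_subtype_compl,
      Fintype.card_subtype_eq]
  rw [hcard, Nat.card_congr (MulAction.selfEquivSigmaOrbits E {v : V // v ≠ 1}), Nat.card_sigma]
  refine Finset.dvd_sum fun ω _ => ?_
  have h := MulAction.card_orbit_mul_card_stabilizer_eq_card_group E ω.out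
  have h2 : Fintype.card (MulAction.stabilizer E ω.out) = 1 := by
    rw [Fintype.card_eq_one_iff]
    refine ⟨1, fun y => Subtype.ext ?_⟩
    exact (hstab ω.out).le y.2
  rw [h2, mul_one] at h
  rw [Nat.card_eq_fintype_card, Nat.card_eq_fintype_card, ← h]

end FixedPointFree

/-- A nonsolvable finite group whose nontrivial elements have prime order, such that elements of
equal order are related by an automorphism, and whose order has three prime divisors. -/
structure HasPrimeOrderOrbits (G : Type*) [Group G] : Prop where
  not_isSolvable : ¬ Group.IsSolvable G
  prime_orderOf : ∀ g : G, g ≠ 1 → (orderOf g).Prime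
  exists_mulAut : ∀ g h : G, orderOf g = orderOf h → ∃ φ : MulAut G, φ g = h
  card_primeFactors : (Nat.card G).primeFactors.card = 3

theorem hasPrimeOrderOrbits_of_omegaAut_le_four {G : Type*} [Group G] [Finite G]
    (h : omegaAut G ≤ 4) (hG : ¬ Group.IsSolvable G) : HasPrimeOrderOrbits G := by
  classical
  have h3 : 3 ≤ (Nat.card G).primeFactors.card := by
    by_contra hlt
    exact hG (Group.isSolvable_of_card_primeFactors_le_two (by omega))
  let Q := MulAction.orbitRel.Quotient (MulAut G) G
  have : Fintype Q := Fintype.ofFinite Q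
  let f : Q → ℕ := Quotient.lift orderOf (fun a b hab => by
    obtain ⟨φ, rfl⟩ := hab
    exact MulEquiv.orderOf_eq φ b)
  have hf : ∀ g : G, f (Quotient.mk _ g) = orderOf g := fun g => rfl
  have hQ : Fintype.card Q ≤ 4 := by rwa [← Nat.card_eq_fintype_card]
  have hsub : insert 1 (Nat.card G).primeFactors ⊆ Finset.univ.image f := by
    intro p hp
    rcases Finset.mem_insert.mp hp with rfl | hp
    · exact Finset.mem_image.mpr ⟨Quotient.mk _ 1, Finset.mem_univ _, by rw [hf, orderOf_one]⟩
    · have : Fact p.Prime := ⟨Nat.prime_of_mem_primeFactors hp⟩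
      obtain ⟨g, hg⟩ := exists_prime_orderOf_dvd_card' p (Nat.dvd_of_mem_primeFactors hp)
      exact Finset.mem_image.mpr ⟨Quotient.mk _ g, Finset.mem_univ _, by rw [hf, hg]⟩
  have hins : (insert 1 (Nat.card G).primeFactors).card = (Nat.card G).primeFactors.card + 1 :=
    Finset.card_insert_of_notMem fun h => Nat.not_prime_one (Nat.prime_of_mem_primeFactors h)
  have himg : (Finset.univ.image f).card ≤ Fintype.card Q := Finset.card_image_le
  have hle := Finset.card_le_card hsub
  have heq : insert 1 (Nat.card G).primeFactors = Finset.univ.image f :=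
    Finset.eq_of_subset_of_card_le hsub (by omega)
  have hinj : Function.Injective f := by
    have hon : Set.InjOn f (Finset.univ : Finset Q) := Finset.card_image_iff.mp (by
      rw [Finset.card_univ]
      omega)
    rwa [Finset.coe_univ, Set.injOn_univ] at hon
  refine ⟨hG, fun g hg => ?_, fun g k hgk => ?_, by omega⟩
  · have hmem : orderOf g ∈ insert 1 (Nat.card G).primeFactors := by
      rw [heq]
      exact Finset.mem_image.mpr ⟨Quotient.mk _ g, Finset.mem_univ _, hf g⟩
    rcases Finset.mem_insert.mp hmem with h1 | h1
    · exact absurd (orderOf_eq_one_iff.mp h1) hg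
    · exact Nat.prime_of_mem_primeFactors h1
  · have h1 : (Quotient.mk _ k : Q) = Quotient.mk _ g := hinj (by rw [hf, hf, hgk])
    obtain ⟨φ, hφ⟩ := Quotient.exact h1
    exact ⟨φ, hφ⟩

namespace HasPrimeOrderOrbits

variable {G : Type*} [Group G] [Finite G] (hG : HasPrimeOrderOrbits G)
include hG

theorem isSolvable_of_dvd_of_not_dvd {H : Type*} [Group H] [Finite H]
    (hH : Nat.card H ∣ Nat.card G) {p : ℕ} (hp : p.Prime) (hpG : p ∣ Nat.card G)
    (hpH : ¬ p ∣ Nat.card H) : Group.IsSolvable H := by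
  refine Group.isSolvable_of_card_primeFactors_le_two ?_
  have hsub : (Nat.card H).primeFactors ⊆ (Nat.card G).primeFactors.erase p := by
    intro q hq
    refine Finset.mem_erase.mpr ⟨?_, Nat.primeFactors_mono hH Nat.card_pos.ne' hq⟩
    rintro rfl
    exact hpH (Nat.dvd_of_mem_primeFactors hq)
  have h := Finset.card_le_card hsub
  rw [Finset.card_erase_of_mem (Nat.mem_primeFactors.mpr ⟨hp, hpG, Nat.card_pos.ne'⟩),
    hG.card_primeFactors] at h
  exact h

theorem eq_bot_or_eq_top_of_characteristic (N : Subgroup G) [hN : N.Characteristic] :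
    N = ⊥ ∨ N = ⊤ := by
  by_contra! hcon
  obtain ⟨hbot, htop⟩ := hcon
  have hmem : ∀ {g h : G}, orderOf g = orderOf h → g ∈ N → h ∈ N := by
    intro g h hgh hg
    obtain ⟨φ, rfl⟩ := hG.exists_mulAut g h hgh
    have h1 := hN.fixed φ
    rw [← h1] at hg
    exact hg
  obtain ⟨x, hxN, hx1⟩ := N.bot_or_exists_ne_one.resolve_left hbot
  obtain ⟨y, hy⟩ : ∃ y, y ∉ N := by
    by_contra! h
    exact htop (eq_top_iff.mpr fun y _ => h y)
  have hy1 : y ≠ 1 := fun h => hy (h ▸ one_mem N)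
  refine hG.not_isSolvable ((Group.isSolvable_iff_subgroup_quotient N).mpr ⟨?_, ?_⟩)
  · refine hG.isSolvable_of_dvd_of_not_dvd (Subgroup.card_subgroup_dvd_card N)
      (hG.prime_orderOf y hy1) (orderOf_dvd_natCard y) fun hd => ?_
    have : Fact (orderOf y).Prime := ⟨hG.prime_orderOf y hy1⟩
    obtain ⟨w, hw⟩ := exists_prime_orderOf_dvd_card' (orderOf y) hd
    exact hy (hmem (by rw [Subgroup.orderOf_coe, hw]) w.2)
  · refine hG.isSolvable_of_dvd_of_not_dvd (Subgroup.index_dvd_card N)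
      (hG.prime_orderOf x hx1) (orderOf_dvd_natCard x) fun hd => ?_
    have : Fact (orderOf x).Prime := ⟨hG.prime_orderOf x hx1⟩
    obtain ⟨w, hw⟩ := exists_prime_orderOf_dvd_card' (G := G ⧸ N) (orderOf x) hd
    obtain ⟨z, rfl⟩ := QuotientGroup.mk_surjective w
    have hz1 : z ≠ 1 := by
      rintro rfl
      rw [QuotientGroup.mk_one, orderOf_one] at hw
      exact this.out.one_lt.ne hw
    have hzd : orderOf (z : G ⧸ N) ∣ orderOf z := orderOf_map_dvd (QuotientGroup.mk' N) z
    rw [hw, Nat.prime_dvd_prime_iff_eq this.out (hG.prime_orderOf z hz1)] at hzd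
    have hzN := hmem hzd hxN
    rw [(QuotientGroup.eq_one_iff z).mpr hzN, orderOf_one] at hw
    exact this.out.one_lt.ne hw

omit [Finite G] in
theorem isPGroup_centralizer {x : G} (hx : x ≠ 1) :
    IsPGroup (orderOf x) (Subgroup.centralizer {x}) := by
  intro y
  refine ⟨1, ?_⟩
  rw [pow_one]
  by_cases hy : (y : G) = 1
  · ext
    rw [Subgroup.coe_pow, hy, one_pow, Subgroup.coe_one]
  have hxp := hG.prime_orderOf x hx
  have hyp := hG.prime_orderOf y hy
  have hcomm : Commute (y : G) x := Subgroup.mem_centralizer_singleton_iff.mp y.2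
  have heq : orderOf x = orderOf (y : G) := by
    by_contra hne
    have h1 := hcomm.orderOf_mul_eq_mul_orderOf_of_coprime
      ((Nat.coprime_primes hyp hxp).mpr (Ne.symm hne))
    have h2 : ((y : G) * x) ≠ 1 := by
      intro h
      rw [h, orderOf_one] at h1
      exact hxp.one_lt.ne (Nat.eq_one_of_mul_eq_one_left h1.symm).symm
    have h3 := hG.prime_orderOf _ h2
    rw [h1] at h3
    exact Nat.not_prime_mul hyp.one_lt.ne' hxp.one_lt.ne' h3
  ext
  rw [Subgroup.coe_pow, heq, pow_orderOf_eq_one, Subgroup.coe_one]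

theorem exists_sylow_eq_centralizer {p : ℕ} [hp : Fact p.Prime] {x : G} (hx : orderOf x = p) :
    ∃ P : Sylow p G, (P : Subgroup G) = Subgroup.centralizer {x} := by
  obtain ⟨P⟩ : Nonempty (Sylow p G) := inferInstance
  obtain ⟨z, hzP, hz1, hz⟩ := P.exists_mem_ne_one_le_centralizer (hx ▸ orderOf_dvd_natCard x)
  have hzp : orderOf z = p := by
    obtain ⟨k, hk⟩ := P.2 ⟨z, hzP⟩
    have h1 : orderOf z ∣ p ^ k := by
      rw [orderOf_dvd_iff_pow_eq_one]
      exact congrArg Subtype.val hk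
    exact (Nat.prime_dvd_prime_iff_eq (hG.prime_orderOf z hz1) hp.out).mp
      ((hG.prime_orderOf z hz1).dvd_of_dvd_pow h1)
  have hPz : Subgroup.centralizer {z} = P := by
    refine P.3 ?_ hz
    rw [← hzp]
    exact hG.isPGroup_centralizer hz1
  obtain ⟨φ, rfl⟩ := hG.exists_mulAut z x (by rw [hzp, hx])
  have hmap : Subgroup.centralizer {φ z} = P.map (φ : G →* G) := by
    rw [← hPz]
    ext y
    rw [Subgroup.mem_map, Subgroup.mem_centralizer_singleton_iff]
    constructor
    · intro hy
      refine ⟨φ.symm y, Subgroup.mem_centralizer_singleton_iff.mpr ?_, φ.apply_symm_apply y⟩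
      apply φ.injective
      simpa using hy
    · rintro ⟨w, hw, rfl⟩
      rw [Subgroup.mem_centralizer_singleton_iff] at hw
      simpa using congrArg φ hw
  refine ⟨Sylow.ofCard (Subgroup.centralizer {φ z}) ?_, rfl⟩
  rw [hmap, ← P.card_eq_multiplicity]
  exact Nat.card_congr (P.toSubgroup.equivMapOfInjective _ φ.injective).toEquiv.symm

theorem centralizer_eq_sylow {p : ℕ} [Fact p.Prime] {x : G} (hx : orderOf x = p) {P : Sylow p G}
    (hP : (P : Subgroup G) ≤ Subgroup.centralizer {x}) : Subgroup.centralizer {x} = P := by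
  obtain ⟨Q, hQ⟩ := hG.exists_sylow_eq_centralizer hx
  rw [← hQ] at hP ⊢
  exact P.3 Q.2 hP

omit [Finite G] in
theorem orderOf_eq_of_mem_sylow {p : ℕ} [hp : Fact p.Prime] {P : Sylow p G} {x : G} (hx : x ∈ P)
    (hx1 : x ≠ 1) : orderOf x = p := by
  obtain ⟨k, hk⟩ := P.2 ⟨x, hx⟩
  have h1 : orderOf x ∣ p ^ k := by
    rw [orderOf_dvd_iff_pow_eq_one]
    exact congrArg Subtype.val hk
  exact (Nat.prime_dvd_prime_iff_eq (hG.prime_orderOf x hx1) hp.out).mp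
    ((hG.prime_orderOf x hx1).dvd_of_dvd_pow h1)

end HasPrimeOrderOrbits

namespace Sylow

variable {G : Type*} [Group G] {p : ℕ}

/-- The center of a Sylow subgroup, as a subgroup of the ambient group. -/
def ambientCenter (P : Sylow p G) : Subgroup G :=
  (P : Subgroup G) ⊓ Subgroup.centralizer (P : Set G)

theorem mem_ambientCenter {P : Sylow p G} {x : G} :
    x ∈ P.ambientCenter ↔ x ∈ P ∧ ∀ y ∈ P, y * x = x * y := by
  rw [ambientCenter, Subgroup.mem_inf, Subgroup.mem_centralizer_iff]
  rfl

theorem le_centralizer_of_mem_ambientCenter {P : Sylow p G} {x : G} (hx : x ∈ P.ambientCenter) :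
    (P : Subgroup G) ≤ Subgroup.centralizer {x} := fun y hy =>
  Subgroup.mem_centralizer_singleton_iff.mpr ((mem_ambientCenter.mp hx).2 y hy)

theorem map_center_subtype (P : Sylow p G) :
    (Subgroup.center P).map (P : Subgroup G).subtype = P.ambientCenter := by
  ext x
  rw [mem_ambientCenter, Subgroup.mem_map]
  constructor
  · rintro ⟨w, hw, rfl⟩
    exact ⟨w.2, fun y hy => congrArg Subtype.val (Subgroup.mem_center_iff.mp hw ⟨y, hy⟩)⟩
  · rintro ⟨hx, h⟩
    exact ⟨⟨x, hx⟩, Subgroup.mem_center_iff.mpr fun y => Subtype.ext (h y y.2), rfl⟩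

theorem card_ambientCenter (P : Sylow p G) :
    Nat.card P.ambientCenter = Nat.card (Subgroup.center P) := by
  rw [← map_center_subtype]
  exact (Nat.card_congr ((Subgroup.center P).equivMapOfInjective _
    (P : Subgroup G).subtype_injective).toEquiv).symm

theorem card_ambientCenter_smul (P : Sylow p G) (g : G) :
    Nat.card (g • P).ambientCenter = Nat.card P.ambientCenter := by
  rw [card_ambientCenter, card_ambientCenter]
  exact (Nat.card_congr
    (Subgroup.centerCongr (P.equivSMul g)).toEquiv).symm

theorem card_ambientCenter_eq_or_mul_sq_le [Finite G] [hp : Fact p.Prime] (P : Sylow p G) :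
    Nat.card P.ambientCenter = Nat.card P ∨ Nat.card P.ambientCenter * p ^ 2 ≤ Nat.card P := by
  rw [card_ambientCenter]
  have hmul := (Subgroup.center P).card_mul_index
  obtain ⟨n, hn⟩ := IsPGroup.iff_card.mp P.2
  obtain ⟨m, -, hm⟩ := (Nat.dvd_prime_pow hp.out).mp
    (hn ▸ (Subgroup.center P).index_dvd_card)
  rw [hm] at hmul
  have hm' : m = 0 ∨ m = 1 ∨ 2 ≤ m := by omega
  rcases hm' with rfl | rfl | h2
  · left
    rwa [pow_zero, mul_one] at hmul
  · left
    rw [pow_one] at hm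
    have hcyc : IsCyclic (P ⧸ Subgroup.center P) := isCyclic_of_prime_card (p := p) hm
    have hcomm := MonoidHom.isMulCommutative_of_isCyclic_of_ker_le_center
      (QuotientGroup.mk' (Subgroup.center P)) (by simp)
    have htop : Subgroup.center P = ⊤ := by
      rw [eq_top_iff]
      exact fun x _ => Subgroup.mem_center_iff.mpr fun y => hcomm.is_comm.comm y x
    rw [htop, Subgroup.card_top]
  · right
    rw [← hmul]
    exact Nat.mul_le_mul_left _ (Nat.pow_le_pow_right hp.out.pos h2)

theorem prime_dvd_card_ambientCenter [Finite G] [hp : Fact p.Prime] (P : Sylow p G)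
    (hpG : p ∣ Nat.card G) : p ∣ Nat.card P.ambientCenter := by
  have hP := P.dvd_card_of_dvd_card hpG
  have hne : Nontrivial P := by
    rw [← Finite.one_lt_card_iff_nontrivial]
    exact hp.out.one_lt.trans_le (Nat.le_of_dvd Nat.card_pos hP)
  rw [card_ambientCenter]
  refine ((P.2.to_subgroup (Subgroup.center P)).card_eq_or_dvd).resolve_left ?_
  have hcne : Nontrivial (Subgroup.center P) := P.2.center_nontrivial
  exact Finite.one_lt_card.ne'

instance normal_ambientCenter_subgroupOf (P : Sylow p G) :
    (P.ambientCenter.subgroupOf (Subgroup.normalizer (P : Set G))).Normal := by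
  refine ⟨fun x hx n => ?_⟩
  rw [Subgroup.mem_subgroupOf, mem_ambientCenter] at hx ⊢
  have hn := Subgroup.mem_normalizer_iff.mp n.2
  refine ⟨(hn x).mp hx.1, fun y hy => ?_⟩
  have h1 : ((n : G)⁻¹ * y * n) ∈ P := by
    refine (hn _).mpr ?_
    have h2 : (n : G) * ((n : G)⁻¹ * y * n) * (n : G)⁻¹ = y := by group
    rw [h2]
    exact hy
  have h3 := hx.2 _ h1
  calc y * (n * x * (n : G)⁻¹) = n * (((n : G)⁻¹ * y * n) * x) * (n : G)⁻¹ := by group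
    _ = n * (x * ((n : G)⁻¹ * y * n)) * (n : G)⁻¹ := by rw [h3]
    _ = n * x * (n : G)⁻¹ * y := by group

/-- The index of a Sylow subgroup in its normalizer. -/
noncomputable def weylCard (P : Sylow p G) : ℕ :=
  (P : Subgroup G).relIndex (Subgroup.normalizer (P : Set G))

theorem card_mul_weylCard_mul_card [Finite G] [Fact p.Prime] (P : Sylow p G) :
    Nat.card P * P.weylCard * Nat.card (Sylow p G) = Nat.card G := by
  rw [P.card_eq_index_normalizer, mul_assoc]
  have h := Subgroup.relIndex_mul_index (Subgroup.le_normalizer (H := (P : Subgroup G)))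
  exact (congrArg (Nat.card P * ·) h).trans (Subgroup.card_mul_index _)

theorem not_dvd_weylCard [Finite G] [Fact p.Prime] (P : Sylow p G) : ¬ p ∣ P.weylCard := by
  intro h
  refine P.not_dvd_index (h.trans ?_)
  exact Dvd.intro _ (Subgroup.relIndex_mul_index (Subgroup.le_normalizer (H := (P : Subgroup G))))

end Sylow

namespace HasPrimeOrderOrbits

variable {G : Type*} [Group G] [Finite G] (hG : HasPrimeOrderOrbits G)
  {p : ℕ} [hp : Fact p.Prime] (P : Sylow p G)
include hG

theorem centralizer_eq_of_mem_ambientCenter {x : G} (hx : x ∈ P.ambientCenter) (hx1 : x ≠ 1) :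
    Subgroup.centralizer {x} = P :=
  hG.centralizer_eq_sylow (hG.orderOf_eq_of_mem_sylow (Sylow.mem_ambientCenter.mp hx).1 hx1)
    (Sylow.le_centralizer_of_mem_ambientCenter hx)

theorem card_orderOf_eq : Nat.card {x : G // orderOf x = p} =
    Nat.card (Sylow p G) * (Nat.card P.ambientCenter - 1) := by
  classical
  let f : (Σ Q : Sylow p G, {x : Q.ambientCenter // x ≠ 1}) → {x : G // orderOf x = p} :=
    fun a => ⟨a.2.1, hG.orderOf_eq_of_mem_sylow (Sylow.mem_ambientCenter.mp a.2.1.2).1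
      (by simpa using a.2.2)⟩
  have hf : Function.Bijective f := by
    constructor
    · rintro ⟨Q, ⟨⟨x, hxQ⟩, hx1⟩⟩ ⟨R, ⟨⟨y, hyR⟩, hy1⟩⟩ h
      obtain rfl : x = y := congrArg Subtype.val h
      have hx1 : x ≠ 1 := by simpa using hx1
      obtain rfl : Q = R := Sylow.ext (by
        rw [← hG.centralizer_eq_of_mem_ambientCenter Q hxQ hx1,
          ← hG.centralizer_eq_of_mem_ambientCenter R hyR hx1])
      rfl
    · rintro ⟨x, hx⟩
      obtain ⟨Q, hQ⟩ := hG.exists_sylow_eq_centralizer hx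
      have hmem : x ∈ Q.ambientCenter := by
        refine Sylow.mem_ambientCenter.mpr ⟨?_, fun y hy => ?_⟩
        · change x ∈ (Q : Subgroup G)
          rw [hQ, Subgroup.mem_centralizer_singleton_iff]
        · change y ∈ (Q : Subgroup G) at hy
          rwa [hQ, Subgroup.mem_centralizer_singleton_iff] at hy
      have hx1 : x ≠ 1 := by
        rintro rfl
        rw [orderOf_one] at hx
        exact hp.out.one_lt.ne hx
      exact ⟨⟨Q, ⟨⟨x, hmem⟩, by simpa using hx1⟩⟩, rfl⟩
  rw [← Nat.card_congr (Equiv.ofBijective f hf)]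
  have := Fintype.ofFinite (Sylow p G)
  rw [Nat.card_sigma]
  have hcard : ∀ Q : Sylow p G,
      Nat.card {x : Q.ambientCenter // x ≠ 1} = Nat.card P.ambientCenter - 1 := by
    intro Q
    obtain ⟨g, rfl⟩ := MulAction.exists_smul_eq G P Q
    have := Fintype.ofFinite (g • P).ambientCenter
    rw [← P.card_ambientCenter_smul g, Nat.card_eq_fintype_card, Nat.card_eq_fintype_card,
      Fintype.card_subtype_compl,
      Fintype.card_subtype_eq]
  rw [Finset.sum_congr rfl fun Q _ => hcard Q, Finset.sum_const, Finset.card_univ, smul_eq_mul,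
    ← Nat.card_eq_fintype_card]

theorem weylCard_dvd_and (hpG : p ∣ Nat.card G) :
    P.weylCard ∣ Nat.card P.ambientCenter - 1 ∧ (P.weylCard = 1 ∨ P.weylCard.Prime) := by
  set N := Subgroup.normalizer (P : Set G) with hN
  have hPN : (P : Subgroup G) ≤ N := Subgroup.le_normalizer
  set P' := (P : Subgroup G).subgroupOf N with hP'
  have hP'n : P'.Normal := Subgroup.normal_in_normalizer
  have hP'card : Nat.card P' = Nat.card P :=
    Nat.card_congr (Subgroup.subgroupOfEquivOfLe hPN).toEquiv
  have hcop : (Nat.card P').Coprime P'.index := by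
    obtain ⟨n, hn⟩ := IsPGroup.iff_card.mp P.2
    rw [hP'card, hn]
    exact ((Nat.Prime.coprime_iff_not_dvd hp.out).mpr P.not_dvd_weylCard).pow_left n
  obtain ⟨E, hE⟩ := Subgroup.exists_right_complement'_of_coprime hcop
  have hEcard : Nat.card E = P.weylCard := hE.symm.index_eq_card.symm
  set V := P.ambientCenter.subgroupOf N with hV
  have hVle : P.ambientCenter ≤ N := fun x hx => hPN (Sylow.mem_ambientCenter.mp hx).1
  have hVcard : Nat.card V = Nat.card P.ambientCenter :=
    Nat.card_congr (Subgroup.subgroupOfEquivOfLe hVle).toEquiv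
  have hVn : V.Normal := P.normal_ambientCenter_subgroupOf
  let _ : CommGroup V :=
    { (inferInstance : Group V) with
      mul_comm := fun a b => by
        have ha := Sylow.mem_ambientCenter.mp (Subgroup.mem_subgroupOf.mp a.2)
        have hb := Sylow.mem_ambientCenter.mp (Subgroup.mem_subgroupOf.mp b.2)
        exact Subtype.ext (Subtype.ext (hb.2 _ ha.1)) }
  let θ : E →* MulAut V := (MulAut.conjNormal (H := V)).comp E.subtype
  have hfree : ∀ e v, θ e v = v → e = 1 ∨ v = 1 := by
    intro e v h
    by_contra! hcon
    have hv1 : ((v : N) : G) ≠ 1 := by simpa using hcon.2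
    have hC := hG.centralizer_eq_of_mem_ambientCenter P (Subgroup.mem_subgroupOf.mp v.2) hv1
    have h1 : ((e : N) : G) * (v : N) * ((e : N) : G)⁻¹ = (v : N) :=
      congrArg (fun w : V => ((w : N) : G)) h
    have h2 : ((e : N) : G) ∈ (P : Subgroup G) := by
      rw [← hC, Subgroup.mem_centralizer_singleton_iff]
      exact mul_inv_eq_iff_eq_mul.mp h1
    have h3 : (e : N) ∈ P' ⊓ E := ⟨Subgroup.mem_subgroupOf.mpr h2, e.2⟩
    rw [hE.disjoint.eq_bot, Subgroup.mem_bot] at h3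
    exact hcon.1 (Subtype.ext h3)
  refine ⟨?_, ?_⟩
  · rw [← hEcard, ← hVcard]
    exact card_dvd_card_sub_one_of_fixedPointFree θ hfree
  · have hVp : p ∣ Nat.card V := hVcard ▸ P.prime_dvd_card_ambientCenter hpG
    obtain ⟨v, hv⟩ := exists_prime_orderOf_dvd_card' p hVp
    have hpE : ¬ p ∣ Nat.card E := hEcard ▸ P.not_dvd_weylCard
    rw [← hEcard]
    refine card_eq_one_or_prime_of_fixedPointFree θ hfree (fun e he => ?_) ?_ hpE hv
    · rw [← Subgroup.orderOf_coe, ← Subgroup.orderOf_coe]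
      exact hG.prime_orderOf _ (by simpa using he)
    · have hEG : Nat.card E ∣ Nat.card G :=
        (Subgroup.card_subgroup_dvd_card E).trans (Subgroup.card_subgroup_dvd_card N)
      have hsub : (Nat.card E).primeFactors ⊆ (Nat.card G).primeFactors.erase p := by
        intro q hq
        refine Finset.mem_erase.mpr ⟨?_, Nat.primeFactors_mono hEG Nat.card_pos.ne' hq⟩
        rintro rfl
        exact hpE (Nat.dvd_of_mem_primeFactors hq)
      have h := Finset.card_le_card hsub
      rw [Finset.card_erase_of_mem (Nat.mem_primeFactors.mpr ⟨hp.out, hpG, Nat.card_pos.ne'⟩),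
        hG.card_primeFactors] at h
      exact h

theorem weylCard_ne_one (hpG : p ∣ Nat.card G)
    (hcomm : Nat.card P.ambientCenter = Nat.card P) : P.weylCard ≠ 1 := by
  intro h1
  have hNP : Subgroup.normalizer (P : Set G) ≤ P := Subgroup.relIndex_eq_one.mp h1
  have hZ : P.ambientCenter = P := Subgroup.eq_of_le_of_card_ge inf_le_left hcomm.ge
  have hle : Subgroup.normalizer (P : Set G) ≤ Subgroup.centralizer (P : Set G) :=
    hNP.trans (hZ.ge.trans inf_le_right)
  have hK := MonoidHom.ker_transferSylow_isComplement' P hle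
  set K := (MonoidHom.transferSylow P hle).ker
  have hidx : K.index = Nat.card P := hK.symm.index_eq_card
  refine hG.not_isSolvable ((Group.isSolvable_iff_subgroup_quotient K).mpr ⟨?_, ?_⟩)
  · refine hG.isSolvable_of_dvd_of_not_dvd (Subgroup.card_subgroup_dvd_card K) hp.out hpG ?_
    have h2 : (P : Subgroup G).index = Nat.card K := hK.index_eq_card
    rw [← h2]
    exact P.not_dvd_index
  · refine Group.isSolvable_of_card_primeFactors_le_two ?_
    obtain ⟨n, hn⟩ := IsPGroup.iff_card.mp P.2
    have h3 : Nat.card (G ⧸ K) = p ^ n := hidx.trans hn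
    rw [h3]
    have hsub : (p ^ n).primeFactors ⊆ {p} := fun q hq =>
      Finset.mem_singleton.mpr ((Nat.prime_dvd_prime_iff_eq (Nat.prime_of_mem_primeFactors hq)
        hp.out).mp ((Nat.prime_of_mem_primeFactors hq).dvd_of_dvd_pow
          (Nat.dvd_of_mem_primeFactors hq)))
    exact (Finset.card_le_card hsub).trans (by simp)

end HasPrimeOrderOrbits

section Numerics

theorem orbit_equation_inverted {p q P Q R : ℤ} (hp : 3 ≤ p) (hq : 3 ≤ q) (hpq : 8 ≤ p + q)
    (hP : p ≤ P) (hQ : q ≤ Q) (hR : 2 ≤ R)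
    (h : q * p * (R - 1) * P * Q + p * p * (P - 1) * Q * R + p * q * (Q - 1) * P * R =
      p * q * p * (P * Q * R - 1)) : False := by
  have hPQ : p * q ≤ P * Q := mul_le_mul hP hQ (by linarith) (by linarith)
  have hpq0 : 0 < p * q := by positivity
  have hN : 2 * (p * q) ≤ P * Q * R := by nlinarith
  have h1 : q * P * Q + p * Q * R + q * P * R + P * Q * R * (p * q - 2 * q - p) = p * q := by
    have h2 : p * (q * P * Q + p * Q * R + q * P * R + P * Q * R * (p * q - 2 * q - p)) =
        p * (p * q) := by linear_combination -h
    exact mul_left_cancel₀ (by linarith) h2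
  have h3 : 1 ≤ p * q - 2 * q - p := by nlinarith
  have hP0 : 0 < P := by linarith
  have hQ0 : 0 < Q := by linarith
  have h4 : 0 < q * P * Q + p * Q * R + q * P * R := by positivity
  nlinarith

theorem orbit_equation_mixed {p P Q R : ℤ} (hp : 3 ≤ p) (hP : p ≤ P) (hQ : 2 ≤ Q) (hR : 2 ≤ R)
    (h : 2 * p * (R - 1) * P * Q + p * p * (P - 1) * Q * R + p * 2 * (Q - 1) * P * R =
      p * 2 * p * (P * Q * R - 1)) : p ≤ 4 := by
  by_contra hp5
  have hQR : 4 ≤ Q * R := by nlinarith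
  have hN : 4 * p ≤ P * Q * R := by nlinarith
  have h1 : 2 * P * Q + p * Q * R + 2 * P * R + P * Q * R * (p - 4) = 2 * p := by
    have h2 : p * (2 * P * Q + p * Q * R + 2 * P * R + P * Q * R * (p - 4)) =
        p * (2 * p) := by linear_combination -h
    exact mul_left_cancel₀ (by linarith) h2
  have hP0 : 0 < P := by linarith
  have h4 : 0 < 2 * P * Q + p * Q * R + 2 * P * R := by positivity
  nlinarith

theorem orbit_equation_mixed_three {P Q R k : ℤ} (hP : P = 3 * k) (hk : k = 1 ∨ 3 ∣ k)
    (hQ : 2 ≤ Q) (hR : 2 ≤ R) (hQ3 : 3 ∣ Q - 1) (hR3 : 3 ∣ R - 1)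
    (h : 2 * 3 * (R - 1) * P * Q + 3 * 3 * (P - 1) * Q * R + 3 * 2 * (Q - 1) * P * R =
      3 * 2 * 3 * (P * Q * R - 1)) : False := by
  subst hP
  rcases hk with rfl | ⟨j, rfl⟩
  · nlinarith
  · obtain ⟨a, ha⟩ := hQ3
    obtain ⟨b, hb⟩ := hR3
    have h1 : 3 * j * Q * R = 6 * j * Q + Q * R + 6 * j * R - 2 := by linarith
    have h2 : 3 * (j * Q * R - 2 * j * Q - 2 * j * R - 3 * a * b - a - b) = -1 := by
      have hQ' : Q = 3 * a + 1 := by linarith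
      have hR' : R = 3 * b + 1 := by linarith
      rw [hQ', hR'] at h1 ⊢
      linarith
    omega

theorem orbit_equation_cyclic {p q P Q R : ℤ} (hp : 3 ≤ p) (hq : 3 ≤ q) (hP : p ≤ P)
    (hQ : q ≤ Q) (hR : 2 ≤ R)
    (h : q * 2 * (R - 1) * P * Q + p * 2 * (P - 1) * Q * R + p * q * (Q - 1) * P * R =
      p * q * 2 * (P * Q * R - 1)) : p * q ≤ 2 * p + 2 * q := by
  by_contra hlt
  have hPQ : p * q ≤ P * Q := mul_le_mul hP hQ (by linarith) (by linarith)
  have hpq0 : 0 < p * q := by positivity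
  have hN : 2 * (p * q) ≤ P * Q * R := by nlinarith
  have hP0 : 0 < P := by linarith
  have hQ0 : 0 < Q := by linarith
  have h4 : 0 < 2 * q * P * Q + 2 * p * Q * R + p * q * P * R := by positivity
  have h1 : 2 * q * P * Q + 2 * p * Q * R + p * q * P * R +
      P * Q * R * (p * q - 2 * p - 2 * q) = 2 * (p * q) := by linear_combination -h
  nlinarith

theorem orbit_equation_cyclic_three_five {P Q R k : ℤ} (hQ : Q = 5 * k) (hk : k = 1 ∨ 5 ∣ k)
    (hP : 3 ≤ P) (hR : 2 ≤ R) (hP5 : 5 ∣ P - 1)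
    (h : 5 * 2 * (R - 1) * P * Q + 3 * 2 * (P - 1) * Q * R + 3 * 5 * (Q - 1) * P * R =
      3 * 5 * 2 * (P * Q * R - 1)) : 5 ∣ R - 2 := by
  subst hQ
  rcases hk with rfl | ⟨j, rfl⟩
  · nlinarith
  · obtain ⟨a, ha⟩ := hP5
    have hP' : P = 5 * a + 1 := by linarith
    have h1 : 5 * j * (P * R - 10 * P - 6 * R) = 3 * P * R - 6 := by linarith
    refine ⟨2 * j * (P * R - 10 * P - 6 * R) - 6 * a * R - R + 2, ?_⟩
    rw [hP'] at h1 ⊢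
    linarith

theorem orbit_equation_cyclic_five_three {P Q R k : ℤ} (hQ : Q = 3 * k) (hk : k = 1 ∨ 3 ∣ k)
    (hP : 3 ≤ P) (hR : 2 ≤ R) (hP3 : 3 ∣ P - 1)
    (h : 3 * 2 * (R - 1) * P * Q + 5 * 2 * (P - 1) * Q * R + 5 * 3 * (Q - 1) * P * R =
      5 * 3 * 2 * (P * Q * R - 1)) : 3 ∣ R - 2 := by
  subst hQ
  rcases hk with rfl | ⟨j, rfl⟩
  · nlinarith
  · obtain ⟨a, ha⟩ := hP3
    have hP' : P = 3 * a + 1 := by linarith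
    have h1 : 3 * j * (P * R - 6 * P - 10 * R) = 5 * P * R - 10 := by linarith
    refine ⟨2 * (R - 2) - j * (P * R - 6 * P - 10 * R) + 5 * a * R, ?_⟩
    rw [hP'] at h1 ⊢
    linarith

theorem orbit_equation_main {p P Q R k : ℤ} (hp : 3 ≤ p) (hP : P = p * k) (hk : k = 1 ∨ p ∣ k)
    (hk0 : 0 < k) (hQ : 3 ≤ Q) (hR : 2 ≤ R) (hpR : p ∣ R - 1)
    (h : 2 * 2 * (R - 1) * P * Q + p * 2 * (P - 1) * Q * R + p * 2 * (Q - 1) * P * R =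
      p * 2 * 2 * (P * Q * R - 1)) : P = p ∧ R = p + 1 ∧ Q = R + 1 := by
  obtain ⟨m, hm⟩ := hpR
  subst hP
  have h1 : 2 * k * Q * (R - 1) + 2 = R * (p * k + Q) := by
    have h2 : (2 * p) * (2 * k * Q * (R - 1) + 2) = (2 * p) * (R * (p * k + Q)) := by
      linear_combination h
    exact mul_left_cancel₀ (by positivity) h2
  have hR4 : 4 ≤ R := by
    have hm0 : 0 < m := by nlinarith
    nlinarith
  rcases hk with rfl | ⟨j, rfl⟩
  · rw [mul_one] at h1 ⊢
    have h3 : Q * (R - 2) = R * p - 2 := by linear_combination h1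
    have hm1 : m = 1 := by
      have hm0 : 0 < m := by nlinarith
      by_contra hne
      have hm2 : 2 ≤ m := by omega
      have h4 : 2 * p ≤ R - 1 := by nlinarith
      have h5 : (Q - p) * (R - 2) = 2 * p - 2 := by linear_combination h3
      have h6 : 0 < Q - p := by
        by_contra hle
        nlinarith
      nlinarith
    rw [hm1, mul_one] at hm
    have h7 : R = p + 1 := by linarith
    refine ⟨rfl, h7, ?_⟩
    have h8 : (R - 2) * Q = (R - 2) * (R + 1) := by
      rw [h7] at h3 ⊢
      linear_combination h3
    exact mul_left_cancel₀ (by linarith) h8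
  · exfalso
    have hj : 0 < j := by
      by_contra hle
      nlinarith
    have hQp : Q < p := by
      by_contra hle
      have hkk : 3 ≤ p * j := by nlinarith
      have h9 : Q * (2 * (p * j) * (R - 1) - R) = R * p * (p * j) - 2 := by linear_combination h1
      have h10 : (p * j) * R ≤ 2 * (p * j) * (R - 1) - R := by nlinarith
      have h11 : p * ((p * j) * R) ≤ Q * (2 * (p * j) * (R - 1) - R) := by
        have : 0 ≤ (p * j) * R := by positivity
        exact mul_le_mul (by linarith) h10 this (by linarith)
      nlinarith
    have hdvd : p ∣ Q - 2 := by
      have hR1 : R = p * m + 1 := by linarith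
      refine ⟨2 * j * Q * (R - 1) - R * (p * j) - m * Q, ?_⟩
      rw [hR1] at h1 ⊢
      linear_combination -h1
    have := Int.le_of_dvd (by linarith) hdvd
    linarith

end Numerics

/-- Numerical constraints relating the order `g` of a group, a prime `s`, the order `S` of a Sylow
`s`-subgroup, the order `z` of its center and its index `e` in its normalizer. -/
structure SylowNumerics (g s S z e : ℕ) : Prop where
  prime : s.Prime
  card_eq : ∃ a, S = s ^ (a + 1)
  center_eq_or_le : z = S ∨ z * s ^ 2 ≤ S
  center_eq_of_two : s = 2 → z = S
  weyl_dvd : e ∣ z - 1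
  weyl_eq_one_or_prime : e = 1 ∨ e.Prime
  weyl_ne_one : z = S → e ≠ 1
  not_dvd_weyl : ¬ s ∣ e
  weyl_dvd_card : e ∣ g

namespace SylowNumerics

variable {g s S z e : ℕ}

theorem weyl_pos (h : SylowNumerics g s S z e) : 0 < e :=
  h.weyl_eq_one_or_prime.elim (fun h => h ▸ one_pos) fun h => h.pos

theorem exists_card_eq_mul (h : SylowNumerics g s S z e) :
    ∃ k, 0 < k ∧ S = s * k ∧ (k = 1 ∨ s ∣ k) := by
  obtain ⟨a, rfl⟩ := h.card_eq
  refine ⟨s ^ a, pow_pos h.prime.pos a, pow_succ' s a, ?_⟩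
  rcases a with - | a
  · exact Or.inl (pow_zero s)
  · exact Or.inr (dvd_pow_self s a.succ_ne_zero)

theorem eq_of_prime_dvd_card (h : SylowNumerics g s S z e) {t : ℕ} (ht : t.Prime) (hd : t ∣ S) :
    t = s := by
  obtain ⟨a, rfl⟩ := h.card_eq
  exact (Nat.prime_dvd_prime_iff_eq ht h.prime).mp (ht.dvd_of_dvd_pow hd)

theorem le_card (h : SylowNumerics g s S z e) : s ≤ S := by
  obtain ⟨k, hk, rfl, -⟩ := h.exists_card_eq_mul
  exact Nat.le_mul_of_pos_right s hk

theorem card_pos (h : SylowNumerics g s S z e) : 0 < S := h.prime.pos.trans_le h.le_card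

theorem ratio_le_of_ne (h : SylowNumerics g s S z e) (hs : 3 ≤ s) (hz : z ≠ S) :
    ((z : ℚ) - 1) / (S * e) ≤ 1 / 9 := by
  have h1 : z * s ^ 2 ≤ S := h.center_eq_or_le.resolve_left hz
  have h2 : z * 9 ≤ S := le_trans (Nat.mul_le_mul_left z (by nlinarith)) h1
  have hS : (0 : ℚ) < S := by exact_mod_cast h.card_pos
  have he : (1 : ℚ) ≤ e := by exact_mod_cast h.weyl_pos
  have h3 : (z : ℚ) * 9 ≤ S := by exact_mod_cast h2
  rw [div_le_div_iff₀ (by positivity) (by norm_num)]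
  nlinarith

theorem ratio_lt (h : SylowNumerics g s S z e) {n : ℕ} (hn : 0 < n) (hne : n ≤ e) :
    ((z : ℚ) - 1) / (S * e) < 1 / n := by
  have hzS : z ≤ S := by
    rcases h.center_eq_or_le with h1 | h1
    · exact h1.le
    · exact (Nat.le_mul_of_pos_right z (pow_pos h.prime.pos 2)).trans h1
  have hS : (0 : ℚ) < S := by exact_mod_cast h.card_pos
  have hz : (z : ℚ) ≤ S := by exact_mod_cast hzS
  have hn' : (0 : ℚ) < n := by exact_mod_cast hn
  have hne' : (n : ℚ) ≤ e := by exact_mod_cast hne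
  have he : (0 : ℚ) < e := by exact_mod_cast h.weyl_pos
  rw [div_lt_div_iff₀ (by positivity) hn']
  nlinarith

theorem ratio_lt_half (h : SylowNumerics g s S z e) (hs : 3 ≤ s) :
    ((z : ℚ) - 1) / (S * e) < 1 / 2 := by
  by_cases hz : z = S
  · have he := (h.weyl_eq_one_or_prime.resolve_left (h.weyl_ne_one hz)).two_le
    exact_mod_cast h.ratio_lt two_pos he
  · have := h.ratio_le_of_ne hs hz
    linarith

theorem ratio_lt_third (h : SylowNumerics g s S z e) (hs : 3 ≤ s) (hg : ¬ 2 ∣ g) :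
    ((z : ℚ) - 1) / (S * e) < 1 / 3 := by
  by_cases hz : z = S
  · have he := (h.weyl_eq_one_or_prime.resolve_left (h.weyl_ne_one hz)).two_le
    have he2 : e ≠ 2 := by
      rintro rfl
      exact hg h.weyl_dvd_card
    exact_mod_cast h.ratio_lt three_pos (by omega : 3 ≤ e)
  · have := h.ratio_le_of_ne hs hz
    linarith

theorem ratio_lt_fifth (h : SylowNumerics g s S z e) (hs : 3 ≤ s) (hg : ¬ 2 ∣ g)
    (h3 : s = 3 ∨ ¬ 3 ∣ g) : ((z : ℚ) - 1) / (S * e) < 1 / 5 := by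
  by_cases hz : z = S
  · have hep := h.weyl_eq_one_or_prime.resolve_left (h.weyl_ne_one hz)
    have he := hep.two_le
    have he2 : e ≠ 2 := by
      rintro rfl
      exact hg h.weyl_dvd_card
    have he3 : e ≠ 3 := by
      rintro rfl
      rcases h3 with rfl | h3
      · exact h.not_dvd_weyl dvd_rfl
      · exact h3 h.weyl_dvd_card
    have he4 : e ≠ 4 := by
      rintro rfl
      exact absurd hep (by norm_num)
    exact_mod_cast h.ratio_lt (by norm_num) (by omega : 5 ≤ e)
  · have := h.ratio_le_of_ne hs hz
    linarith

theorem two_dvd_of_ratio_sum {g p q r P Q R zp zq zr ep eq er : ℕ}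
    (hp : SylowNumerics g p P zp ep) (hq : SylowNumerics g q Q zq eq)
    (hr : SylowNumerics g r R zr er) (hg : g = P * Q * R)
    (hsum : ((zp : ℚ) - 1) / (P * ep) + ((zq : ℚ) - 1) / (Q * eq) + ((zr : ℚ) - 1) / (R * er) =
      1 - 1 / g) : 2 ∣ g := by
  by_contra h2
  have hge : ∀ {s S z e : ℕ}, SylowNumerics g s S z e → S ∣ g → 3 ≤ s := by
    intro s S z e h hS
    have h3 := h.prime.two_le
    have h4 : s ≠ 2 := by
      rintro rfl
      obtain ⟨k, -, rfl, -⟩ := h.exists_card_eq_mul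
      exact h2 ((Dvd.intro _ rfl).trans hS)
    omega
  have hp3 := hge hp (by rw [hg, mul_assoc]; exact dvd_mul_right _ _)
  have hq3 := hge hq (by rw [hg]; exact Dvd.intro_left (P * R) (by ring))
  have hr3 := hge hr (by rw [hg]; exact dvd_mul_left _ _)
  have hg27 : 27 ≤ g := by
    have h1 : 3 * 3 ≤ P * Q := Nat.mul_le_mul (hp3.trans hp.le_card) (hq3.trans hq.le_card)
    have h3 : 3 * 3 * 3 ≤ P * Q * R := Nat.mul_le_mul h1 (hr3.trans hr.le_card)
    omega
  have hginv : (1 : ℚ) / g ≤ 1 / 27 :=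
    one_div_le_one_div_of_le (by norm_num) (by exact_mod_cast hg27)
  have a1 := hp.ratio_lt_third hp3 h2
  have a2 := hq.ratio_lt_third hq3 h2
  have a3 := hr.ratio_lt_third hr3 h2
  by_cases h3 : p = 3 ∨ ¬ 3 ∣ g
  · have := hp.ratio_lt_fifth hp3 h2 h3
    linarith
  by_cases h3' : q = 3 ∨ ¬ 3 ∣ g
  · have := hq.ratio_lt_fifth hq3 h2 h3'
    linarith
  by_cases h3'' : r = 3 ∨ ¬ 3 ∣ g
  · have := hr.ratio_lt_fifth hr3 h2 h3''
    linarith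
  push Not at h3 h3' h3''
  have hd := h3.2
  rw [hg, Nat.prime_three.dvd_mul, Nat.prime_three.dvd_mul] at hd
  rcases hd with (hd | hd) | hd
  · exact h3.1 (hp.eq_of_prime_dvd_card Nat.prime_three hd).symm
  · exact h3'.1 (hq.eq_of_prime_dvd_card Nat.prime_three hd).symm
  · exact h3''.1 (hr.eq_of_prime_dvd_card Nat.prime_three hd).symm

theorem orbit_equation_of_ratio_sum {P Q R ep eq er : ℕ} (hP : 0 < P) (hQ : 0 < Q) (hR : 0 < R)
    (hep : 0 < ep) (heq : 0 < eq) (her : 0 < er)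
    (hsum : ((P : ℚ) - 1) / (P * ep) + ((Q : ℚ) - 1) / (Q * eq) + ((R : ℚ) - 1) / (R * er) =
      1 - 1 / (P * Q * R)) :
    (ep : ℤ) * eq * (R - 1) * P * Q + er * eq * (P - 1) * Q * R + er * ep * (Q - 1) * P * R =
      er * ep * eq * (P * Q * R - 1) := by
  have hP' : (P : ℚ) ≠ 0 := by exact_mod_cast hP.ne'
  have hQ' : (Q : ℚ) ≠ 0 := by exact_mod_cast hQ.ne'
  have hR' : (R : ℚ) ≠ 0 := by exact_mod_cast hR.ne'
  have hep' : (ep : ℚ) ≠ 0 := by exact_mod_cast hep.ne'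
  have heq' : (eq : ℚ) ≠ 0 := by exact_mod_cast heq.ne'
  have her' : (er : ℚ) ≠ 0 := by exact_mod_cast her.ne'
  have h : (ep : ℚ) * eq * (R - 1) * P * Q + er * eq * (P - 1) * Q * R +
      er * ep * (Q - 1) * P * R = er * ep * eq * (P * Q * R - 1) := by
    field_simp at hsum
    linear_combination hsum
  exact_mod_cast h

theorem weyl_eq_or_eq {p q P Q R zp zq zr ep eq er : ℕ}
    (hp : SylowNumerics g p P zp ep) (hq : SylowNumerics g q Q zq eq)
    (hr : SylowNumerics g 2 R zr er) (hg : g = P * Q * R) (hep : ep.Prime) : ep = 2 ∨ ep = q := by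
  have hd := hp.weyl_dvd_card
  rw [hg, hep.dvd_mul, hep.dvd_mul] at hd
  rcases hd with (hd | hd) | hd
  · have h1 := hp.eq_of_prime_dvd_card hep hd
    exact absurd (h1 ▸ dvd_rfl) hp.not_dvd_weyl
  · exact Or.inr (hq.eq_of_prime_dvd_card hep hd)
  · exact Or.inl (hr.eq_of_prime_dvd_card hep hd)

theorem int_dvd_card_sub_one (h : SylowNumerics g s S S e) : (e : ℤ) ∣ (S : ℤ) - 1 := by
  have h1 : (e : ℤ) ∣ ((S - 1 : ℕ) : ℤ) := Int.natCast_dvd_natCast.mpr h.weyl_dvd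
  rwa [Nat.cast_sub (h.prime.pos.trans_le h.le_card), Nat.cast_one] at h1

theorem exists_int_card_eq_mul (h : SylowNumerics g s S z e) :
    ∃ k : ℤ, 0 < k ∧ (S : ℤ) = s * k ∧ (k = 1 ∨ (s : ℤ) ∣ k) := by
  obtain ⟨k, hk, rfl, h1⟩ := h.exists_card_eq_mul
  refine ⟨k, by exact_mod_cast hk, by push_cast; rfl, ?_⟩
  exact h1.imp (fun h => by exact_mod_cast h) Int.natCast_dvd_natCast.mpr

theorem two_pow_mod_fifteen (c : ℕ) :
    2 ^ c % 15 = 1 ∨ 2 ^ c % 15 = 2 ∨ 2 ^ c % 15 = 4 ∨ 2 ^ c % 15 = 8 := by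
  induction c with
  | zero => simp
  | succ c ih =>
    rw [pow_succ]
    omega

theorem not_five_dvd_two_pow_sub_two {c : ℕ} (h : 3 ∣ 2 ^ c - 1) : ¬ (5 : ℤ) ∣ (2 : ℤ) ^ c - 2 := by
  have h1 := two_pow_mod_fifteen c
  have h2 : ((2 ^ c : ℕ) : ℤ) = (2 : ℤ) ^ c := by push_cast; rfl
  rw [← h2]
  clear h2
  generalize 2 ^ c = x at *
  omega

theorem not_three_dvd_two_pow_sub_two {c : ℕ} (h : 5 ∣ 2 ^ c - 1) :
    ¬ (3 : ℤ) ∣ (2 : ℤ) ^ c - 2 := by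
  have h1 := two_pow_mod_fifteen c
  have h2 : ((2 ^ c : ℕ) : ℤ) = (2 : ℤ) ^ c := by push_cast; rfl
  rw [← h2]
  clear h2
  generalize 2 ^ c = x at *
  omega

theorem eq_of_ratio_sum {g p q P Q R zp zq zr ep eq : ℕ}
    (hp : SylowNumerics g p P zp ep) (hq : SylowNumerics g q Q zq eq)
    (hr : SylowNumerics g 2 R zr p) (hg : g = P * Q * R) (hpq : p ≠ q) (hp2 : p ≠ 2) (hq2 : q ≠ 2)
    (hsum : ((zp : ℚ) - 1) / (P * ep) + ((zq : ℚ) - 1) / (Q * eq) + ((zr : ℚ) - 1) / (R * p) =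
      1 - 1 / g) :
    P = p ∧ R = p + 1 ∧ Q = R + 1 ∧ ep = 2 ∧ eq = 2 ∧ zp = P ∧ zq = Q := by
  have hp3 : 3 ≤ p := by have := hp.prime.two_le; omega
  have hq3 : 3 ≤ q := by have := hq.prime.two_le; omega
  have hPp := hp.le_card
  have hQq := hq.le_card
  have hR2 := hr.le_card
  have hr' := hr.ratio_lt three_pos hp3
  have hg18 : 18 ≤ g := by
    have h1 : 3 * 3 ≤ P * Q := Nat.mul_le_mul (hp3.trans hPp) (hq3.trans hQq)
    have h3 : 3 * 3 * 2 ≤ P * Q * R := Nat.mul_le_mul h1 hR2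
    omega
  have hginv : (1 : ℚ) / g ≤ 1 / 18 :=
    one_div_le_one_div_of_le (by norm_num) (by exact_mod_cast hg18)
  push_cast at hr'
  obtain rfl : zp = P := by
    by_contra hz
    have h1 := hp.ratio_le_of_ne hp3 hz
    have h2 := hq.ratio_lt_half hq3
    linarith
  obtain rfl : zq = Q := by
    by_contra hz
    have h1 := hq.ratio_le_of_ne hq3 hz
    have h2 := hp.ratio_lt_half hp3
    linarith
  obtain rfl : zr = R := hr.center_eq_of_two rfl
  have hep := hp.weyl_eq_one_or_prime.resolve_left (hp.weyl_ne_one rfl)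
  have heq := hq.weyl_eq_one_or_prime.resolve_left (hq.weyl_ne_one rfl)
  rw [hg] at hsum
  push_cast at hsum
  have h := orbit_equation_of_ratio_sum hp.card_pos hq.card_pos hr.card_pos hp.weyl_pos
    hq.weyl_pos hr.weyl_pos hsum
  have hep' := weyl_eq_or_eq hp hq hr hg hep
  have heq' := weyl_eq_or_eq hq hp hr (by rw [hg]; ring) heq
  have hp3' : (3 : ℤ) ≤ p := by exact_mod_cast hp3
  have hq3' : (3 : ℤ) ≤ q := by exact_mod_cast hq3
  have hPp' : (p : ℤ) ≤ zp := by exact_mod_cast hPp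
  have hQq' : (q : ℤ) ≤ zq := by exact_mod_cast hQq
  have hR2' : (2 : ℤ) ≤ zr := by exact_mod_cast hR2
  have hrd := hr.int_dvd_card_sub_one
  have hpd := hp.int_dvd_card_sub_one
  have hqd := hq.int_dvd_card_sub_one
  obtain ⟨k, hk0, hPk, hk⟩ := hp.exists_int_card_eq_mul
  obtain ⟨j, hj0, hQj, hj⟩ := hq.exists_int_card_eq_mul
  obtain ⟨c, hc⟩ := hr.card_eq
  rcases hep' with rfl | rfl <;> rcases heq' with rfl | rfl
  · push_cast at h
    obtain ⟨h1, h2, h3⟩ := orbit_equation_main hp3' hPk hk hk0 (by linarith) hR2' hrd h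
    exact ⟨by exact_mod_cast h1, by exact_mod_cast h2, by exact_mod_cast h3, rfl, rfl, rfl, rfl⟩
  · push_cast at h
    have h4 := orbit_equation_mixed hp3' hPp' (by linarith) hR2' h
    obtain rfl : eq = 3 := by
      have h5 : eq ≤ 4 := by exact_mod_cast h4
      have h6 : eq ≠ 4 := by
        rintro rfl
        exact absurd heq (by norm_num)
      omega
    push_cast at *
    exact (orbit_equation_mixed_three hPk hk (by linarith) hR2' hqd hrd h).elim
  · push_cast at h
    have h4 := orbit_equation_cyclic hp3' hq3' hPp' hQq' hR2' h
    have h5 : p * ep ≤ 2 * p + 2 * ep := by exact_mod_cast h4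
    have h6 : (p = 3 ∧ ep = 5) ∨ (p = 5 ∧ ep = 3) := by
      have hp4 : p ≠ 4 := by rintro rfl; exact absurd hp.prime (by norm_num)
      have hq4 : ep ≠ 4 := by rintro rfl; exact absurd hep (by norm_num)
      have hp6 : p ≠ 6 := by rintro rfl; exact absurd hp.prime (by norm_num)
      have hq6 : ep ≠ 6 := by rintro rfl; exact absurd hep (by norm_num)
      have hp7 : p ≤ 6 := by nlinarith
      have hq7 : ep ≤ 6 := by nlinarith
      interval_cases p <;> omega
    rcases h6 with ⟨rfl, rfl⟩ | ⟨rfl, rfl⟩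
    · push_cast at *
      have h7 := orbit_equation_cyclic_three_five hQj hj hPp' hR2' hpd h
      have h8 := hr.weyl_dvd
      rw [hc] at h7 h8
      push_cast at h7
      exact (not_five_dvd_two_pow_sub_two h8 h7).elim
    · push_cast at *
      have h7 := orbit_equation_cyclic_five_three hQj hj (by linarith) hR2' hpd h
      have h8 := hr.weyl_dvd
      rw [hc] at h7 h8
      push_cast at h7
      exact (not_three_dvd_two_pow_sub_two h8 h7).elim
  · refine (orbit_equation_inverted hp3' hq3' ?_ hPp' hQq' hR2' h).elim
    have h10 : 8 ≤ eq + ep := by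
      have hp4 : eq ≠ 4 := by rintro rfl; exact absurd heq (by norm_num)
      have hq4 : ep ≠ 4 := by rintro rfl; exact absurd hep (by norm_num)
      omega
    exact_mod_cast h10

end SylowNumerics

namespace HasPrimeOrderOrbits

variable {G : Type*} [Group G] [Finite G] (hG : HasPrimeOrderOrbits G)
include hG

omit [Finite G] in
theorem ambientCenter_eq_of_two (P : Sylow 2 G) : P.ambientCenter = P := by
  have hsq : ∀ x ∈ P, x * x = 1 := by
    intro x hx
    by_cases hx1 : x = 1
    · rw [hx1, one_mul]
    · have h := pow_orderOf_eq_one x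
      have : Fact (Nat.Prime 2) := ⟨Nat.prime_two⟩
      rwa [hG.orderOf_eq_of_mem_sylow hx hx1, pow_two] at h
  refine le_antisymm inf_le_left fun x hx => Sylow.mem_ambientCenter.mpr ⟨hx, fun y hy => ?_⟩
  have hinv : ∀ z ∈ P, z⁻¹ = z := fun z hz => inv_eq_of_mul_eq_one_left (hsq z hz)
  have h := hinv (y * x) (mul_mem hy hx)
  rw [mul_inv_rev, hinv x hx, hinv y hy] at h
  exact h.symm

theorem sylowNumerics {p : ℕ} [hp : Fact p.Prime] (P : Sylow p G) (hpG : p ∣ Nat.card G) :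
    SylowNumerics (Nat.card G) p (Nat.card P) (Nat.card P.ambientCenter) P.weylCard where
  prime := hp.out
  card_eq := by
    obtain ⟨n, hn⟩ := IsPGroup.iff_card.mp P.2
    rcases n with - | n
    · have h := P.dvd_card_of_dvd_card hpG
      rw [hn, pow_zero] at h
      exact absurd h hp.out.not_dvd_one
    · exact ⟨n, hn⟩
  center_eq_or_le := P.card_ambientCenter_eq_or_mul_sq_le
  center_eq_of_two := by
    rintro rfl
    rw [hG.ambientCenter_eq_of_two P]
  weyl_dvd := (hG.weylCard_dvd_and P hpG).1
  weyl_eq_one_or_prime := (hG.weylCard_dvd_and P hpG).2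
  weyl_ne_one := hG.weylCard_ne_one P hpG
  not_dvd_weyl := P.not_dvd_weylCard
  weyl_dvd_card := by
    rw [← P.card_mul_weylCard_mul_card]
    exact (Dvd.intro_left _ rfl).trans (Dvd.intro _ rfl)

theorem ratio_eq {p : ℕ} [Fact p.Prime] (P : Sylow p G) :
    ((Nat.card P.ambientCenter : ℚ) - 1) / (Nat.card P * P.weylCard) =
      (Nat.card {x : G // orderOf x = p} : ℚ) / Nat.card G := by
  have hz : 1 ≤ Nat.card P.ambientCenter := Nat.card_pos
  have hg : (Nat.card G : ℚ) ≠ 0 := by exact_mod_cast Nat.card_pos.ne'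
  rw [hG.card_orderOf_eq P]
  rw [← P.card_mul_weylCard_mul_card] at hg ⊢
  push_cast [Nat.cast_sub hz] at hg ⊢
  have h1 := (mul_ne_zero_iff.mp hg).1
  have h2 := (mul_ne_zero_iff.mp hg).2
  rw [mul_comm (Nat.card (Sylow p G) : ℚ) (_ - 1), mul_div_mul_right _ _ h2]

variable {p q r : ℕ} [hp : Fact p.Prime] [hq : Fact q.Prime] [hr : Fact r.Prime]

theorem ratio_sum (hpqr : (Nat.card G).primeFactors = {p, q, r}) (hpq : p ≠ q) (hpr : p ≠ r)
    (hqr : q ≠ r) (P : Sylow p G) (Q : Sylow q G) (R : Sylow r G) :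
    ((Nat.card P.ambientCenter : ℚ) - 1) / (Nat.card P * P.weylCard) +
      ((Nat.card Q.ambientCenter : ℚ) - 1) / (Nat.card Q * Q.weylCard) +
      ((Nat.card R.ambientCenter : ℚ) - 1) / (Nat.card R * R.weylCard) =
      1 - 1 / Nat.card G := by
  classical
  have := Fintype.ofFinite G
  have hmaps : ∀ x ∈ (Finset.univ : Finset G), orderOf x ∈ ({1, p, q, r} : Finset ℕ) := by
    intro x _
    by_cases hx : x = 1
    · simp [hx]
    · refine Finset.mem_insert_of_mem (hpqr ▸ Nat.mem_primeFactors.mpr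
        ⟨hG.prime_orderOf x hx, orderOf_dvd_natCard x, Nat.card_pos.ne'⟩)
  have hcount := Finset.card_eq_sum_card_fiberwise (f := fun x : G => orderOf x) hmaps
  have hone : (1 : ℕ) ∉ ({p, q, r} : Finset ℕ) := by
    simp [hp.out.one_lt.ne, hq.out.one_lt.ne, hr.out.one_lt.ne]
  have hp' : p ∉ ({q, r} : Finset ℕ) := by simp [hpq, hpr]
  have hq' : q ∉ ({r} : Finset ℕ) := by simp [hqr]
  rw [Finset.sum_insert hone, Finset.sum_insert hp', Finset.sum_insert hq',
    Finset.sum_singleton, Finset.card_univ, ← Nat.card_eq_fintype_card] at hcount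
  have hfib : ∀ n : ℕ, (Finset.univ.filter fun x : G => orderOf x = n).card =
      Nat.card {x : G // orderOf x = n} := by
    intro n
    rw [Nat.card_eq_fintype_card, Fintype.card_subtype]
  have h1 : (Finset.univ.filter fun x : G => orderOf x = 1).card = 1 := by
    simp only [orderOf_eq_one_iff]
    rw [Finset.filter_eq' Finset.univ (1 : G)]
    simp
  rw [h1, hfib, hfib, hfib] at hcount
  rw [hG.ratio_eq P, hG.ratio_eq Q, hG.ratio_eq R]
  have hg : (Nat.card G : ℚ) ≠ 0 := by exact_mod_cast Nat.card_pos.ne'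
  have hc : (Nat.card G : ℚ) = 1 + (Nat.card {x : G // orderOf x = p} +
    (Nat.card {x : G // orderOf x = q} + Nat.card {x : G // orderOf x = r})) := by
    exact_mod_cast hcount
  rw [eq_sub_iff_add_eq, ← add_div, ← add_div, ← add_div, div_eq_one_iff_eq hg]
  linarith

omit hG in
theorem card_eq_mul_mul (hpqr : (Nat.card G).primeFactors = {p, q, r}) (hpq : p ≠ q) (hpr : p ≠ r)
    (hqr : q ≠ r) (P : Sylow p G) (Q : Sylow q G) (R : Sylow r G) :
    Nat.card G = Nat.card P * Nat.card Q * Nat.card R := by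
  have h := Nat.prod_factorization_pow_eq_self (n := Nat.card G) Nat.card_pos.ne'
  have hp' : p ∉ ({q, r} : Finset ℕ) := by simp [hpq, hpr]
  have hq' : q ∉ ({r} : Finset ℕ) := by simp [hqr]
  rw [Finsupp.prod, Nat.support_factorization, hpqr, Finset.prod_insert hp',
    Finset.prod_insert hq', Finset.prod_singleton, ← P.card_eq_multiplicity,
    ← Q.card_eq_multiplicity, ← R.card_eq_multiplicity, ← mul_assoc] at h
  exact h.symm

end HasPrimeOrderOrbits

namespace HasPrimeOrderOrbits

variable {G : Type*} [Group G] [Finite G] (hG : HasPrimeOrderOrbits G)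
include hG

theorem two_dvd_card : 2 ∣ Nat.card G := by
  obtain ⟨p, q, r, hpq, hpr, hqr, hpqr⟩ := Finset.card_eq_three.mp hG.card_primeFactors
  have hpf : p ∈ (Nat.card G).primeFactors := by simp [hpqr]
  have hqf : q ∈ (Nat.card G).primeFactors := by simp [hpqr]
  have hrf : r ∈ (Nat.card G).primeFactors := by simp [hpqr]
  have := Fact.mk (Nat.prime_of_mem_primeFactors hpf)
  have := Fact.mk (Nat.prime_of_mem_primeFactors hqf)
  have := Fact.mk (Nat.prime_of_mem_primeFactors hrf)
  have P : Sylow p G := default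
  have Q : Sylow q G := default
  have R : Sylow r G := default
  exact SylowNumerics.two_dvd_of_ratio_sum
    (hG.sylowNumerics P (Nat.dvd_of_mem_primeFactors hpf))
    (hG.sylowNumerics Q (Nat.dvd_of_mem_primeFactors hqf))
    (hG.sylowNumerics R (Nat.dvd_of_mem_primeFactors hrf))
    (card_eq_mul_mul hpqr hpq hpr hqr P Q R) (hG.ratio_sum hpqr hpq hpr hqr P Q R)

theorem exists_primes_card_eq : ∃ p q : ℕ, p.Prime ∧ q.Prime ∧ p ≠ 2 ∧ q ≠ 2 ∧
    (Nat.card G).primeFactors = {p, q, 2} ∧ Nat.card G = p * (p + 2) * (p + 1) ∧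
    (∀ R : Sylow 2 G, Nat.card R = p + 1 ∧ R.weylCard = p) ∧
    ∀ Q : Sylow q G, Nat.card Q = p + 2 ∧ Q.weylCard = 2 ∧ Nat.card Q.ambientCenter = p + 2 := by
  have : Fact (Nat.Prime 2) := ⟨Nat.prime_two⟩
  have R : Sylow 2 G := default
  have hR := hG.sylowNumerics R hG.two_dvd_card
  set p := R.weylCard with hpR
  have hpp : p.Prime :=
    hR.weyl_eq_one_or_prime.resolve_left (hR.weyl_ne_one (hR.center_eq_of_two rfl))
  have hp2 : p ≠ 2 := by
    intro h
    exact hR.not_dvd_weyl (h ▸ dvd_rfl)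
  have hpf : p ∈ (Nat.card G).primeFactors :=
    Nat.mem_primeFactors.mpr ⟨hpp, hR.weyl_dvd_card, Nat.card_pos.ne'⟩
  have h2f : 2 ∈ ((Nat.card G).primeFactors.erase p) := Finset.mem_erase.mpr ⟨hp2.symm,
    Nat.mem_primeFactors.mpr ⟨Nat.prime_two, hG.two_dvd_card, Nat.card_pos.ne'⟩⟩
  obtain ⟨q, hq⟩ : ∃ q, (((Nat.card G).primeFactors.erase p).erase 2) = {q} := by
    rw [← Finset.card_eq_one, Finset.card_erase_of_mem h2f, Finset.card_erase_of_mem hpf,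
      hG.card_primeFactors]
  have hqf : q ∈ (((Nat.card G).primeFactors.erase p).erase 2) := hq ▸ Finset.mem_singleton_self q
  have hq2 : q ≠ 2 := Finset.ne_of_mem_erase hqf
  have hqp : q ≠ p := Finset.ne_of_mem_erase (Finset.mem_of_mem_erase hqf)
  have hqf' := Finset.mem_of_mem_erase (Finset.mem_of_mem_erase hqf)
  have hpqr : (Nat.card G).primeFactors = {p, q, 2} := by
    rw [← Finset.insert_erase hpf, ← Finset.insert_erase h2f, hq, Finset.pair_comm]
  have hqp' := Nat.prime_of_mem_primeFactors hqf'
  have := Fact.mk hpp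
  have := Fact.mk hqp'
  have P : Sylow p G := default
  have key : ∀ (R : Sylow 2 G) (Q : Sylow q G), R.weylCard = p → Nat.card R = p + 1 ∧
      Nat.card Q = p + 2 ∧ Q.weylCard = 2 ∧ Nat.card Q.ambientCenter = p + 2 ∧
      Nat.card P = p := by
    intro R Q hRp
    have hP := hG.sylowNumerics P hR.weyl_dvd_card
    have hQ := hG.sylowNumerics Q (Nat.dvd_of_mem_primeFactors hqf')
    have hR := hG.sylowNumerics R hG.two_dvd_card
    have hsum := hG.ratio_sum hpqr hqp.symm hp2 hq2 P Q R
    rw [hRp] at hR hsum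
    obtain ⟨h1, h2, h3, -, h5, -, h7⟩ := SylowNumerics.eq_of_ratio_sum hP hQ hR
      (card_eq_mul_mul hpqr hqp.symm hp2 hq2 P Q R) hqp.symm hp2 hq2 hsum
    exact ⟨h2, by omega, h5, by omega, h1⟩
  have hW : ∀ R' : Sylow 2 G, R'.weylCard = p := by
    intro R'
    have h := R'.card_mul_weylCard_mul_card.trans R.card_mul_weylCard_mul_card.symm
    rw [R'.card_eq_multiplicity, R.card_eq_multiplicity] at h
    have h1 := Nat.eq_of_mul_eq_mul_right Nat.card_pos h
    exact Nat.eq_of_mul_eq_mul_left (pow_pos two_pos _) h1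
  have Q : Sylow q G := default
  refine ⟨p, q, hpp, hqp', hp2, hq2, hpqr, ?_, fun R' => ⟨(key R' Q (hW R')).1, hW R'⟩,
    fun Q' => ?_⟩
  · have h := key R Q hpR.symm
    rw [card_eq_mul_mul hpqr hqp.symm hp2 hq2 P Q R, h.1, h.2.1, h.2.2.2.2]
  · have h := key R Q' hpR.symm
    exact ⟨h.2.1, h.2.2.1, h.2.2.2.1⟩

end HasPrimeOrderOrbits

theorem Sylow.characteristic_ker_toPermHom {G : Type*} [Group G] (p : ℕ) :
    (MulAction.toPermHom G (Sylow p G)).ker.Characteristic := by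
  refine Subgroup.characteristic_iff_le_comap.mpr fun φ g hg => ?_
  rw [Subgroup.mem_comap]
  rw [MonoidHom.mem_ker] at hg ⊢
  ext1 P
  have h1 : ∀ Q : Sylow p G, g • Q = Q := fun Q => congrArg (fun σ => σ Q) hg
  let ψ : MulAut G := φ
  change ψ g • P = P
  have h2 : MulAut.conj (ψ g) = ψ * MulAut.conj g * ψ⁻¹ := by
    ext x
    simp
  rw [Sylow.smul_def, h2, mul_smul, mul_smul, ← Sylow.smul_def, h1, smul_inv_smul]

namespace HasPrimeOrderOrbits

variable {G : Type*} [Group G] [Finite G] (hG : HasPrimeOrderOrbits G)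
include hG

theorem injective_toPermHom_sylow {p : ℕ} [Fact p.Prime] (hcard : 2 ≤ Nat.card (Sylow p G)) :
    Function.Injective (MulAction.toPermHom G (Sylow p G)) := by
  have := Sylow.characteristic_ker_toPermHom (G := G) p
  rw [← MonoidHom.ker_eq_bot_iff]
  refine (hG.eq_bot_or_eq_top_of_characteristic _).resolve_right fun htop => ?_
  have hsub : Subsingleton (Sylow p G) := by
    refine ⟨fun P Q => ?_⟩
    obtain ⟨g, rfl⟩ := MulAction.exists_smul_eq G P Q
    have hg : g ∈ (MulAction.toPermHom G (Sylow p G)).ker := htop ▸ Subgroup.mem_top g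
    exact (congrArg (fun σ => σ P) (MonoidHom.mem_ker.mp hg)).symm
  have := Finite.card_le_one_iff_subsingleton.mpr hsub
  omega

theorem eq_of_orderOf_eq_two_of_smul_eq {y : G} (hy : orderOf y = 2) {P Q : Sylow 2 G}
    (hP : y • P = P) (hQ : y • Q = Q) : P = Q := by
  have : Fact (Nat.Prime 2) := ⟨Nat.prime_two⟩
  have hy1 : y ≠ 1 := by
    rintro rfl
    simp at hy
  have hpg : IsPGroup 2 (Subgroup.zpowers y) :=
    IsPGroup.of_card (n := 1) (by rw [Nat.card_zpowers, hy, pow_one])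
  have key : ∀ R : Sylow 2 G, y • R = R → Subgroup.centralizer {y} = R := by
    intro R hR
    have h1 : y ∈ Subgroup.zpowers y ⊓ Subgroup.normalizer (R : Set G) :=
      ⟨Subgroup.mem_zpowers y, Sylow.smul_eq_iff_mem_normalizer.mp hR⟩
    rw [hpg.inf_normalizer_sylow R] at h1
    refine hG.centralizer_eq_of_mem_ambientCenter R ?_ hy1
    rw [hG.ambientCenter_eq_of_two R]
    exact h1.2
  exact Sylow.ext ((key P hP).symm.trans (key Q hQ))

omit hG in
theorem orderOf_dvd_of_smul_eq {s : ℕ} [Fact s.Prime] {x : G} {P : Sylow s G} (h : x • P = P) :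
    orderOf x ∣ Nat.card P * P.weylCard := by
  have h1 : x ∈ Subgroup.normalizer (P : Set G) := Sylow.smul_eq_iff_mem_normalizer.mp h
  have h2 : Nat.card P * P.weylCard = Nat.card (Subgroup.normalizer (P : Set G)) := by
    have h3 := P.card_mul_weylCard_mul_card
    rw [P.card_eq_index_normalizer] at h3
    exact Nat.eq_of_mul_eq_mul_right (Nat.pos_of_ne_zero Subgroup.index_ne_zero_of_finite)
      (h3.trans (Subgroup.card_mul_index _).symm)
  rw [h2, ← Subgroup.orderOf_mk x h1]
  exact orderOf_dvd_natCard _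

theorem nonempty_mulEquiv : Nonempty (G ≃* alternatingGroup (Fin 5)) := by
  have : Fact (Nat.Prime 2) := ⟨Nat.prime_two⟩
  obtain ⟨p, q, hp, hq, hp2, hq2, hpqr, hcard, hR, hQ⟩ := hG.exists_primes_card_eq
  have := Fact.mk hp
  have := Fact.mk hq
  have hp3 : 3 ≤ p := by have := hp.two_le; omega
  have hqG : q ∣ Nat.card G := Nat.dvd_of_mem_primeFactors (by rw [hpqr]; simp)
  have R : Sylow 2 G := default
  have Q : Sylow q G := default
  have hRn := hG.sylowNumerics R hG.two_dvd_card
  have hQn := hG.sylowNumerics Q hqG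
  have hX : Nat.card (Sylow 2 G) = p + 2 := by
    have h := R.card_mul_weylCard_mul_card
    rw [(hR R).1, (hR R).2, hcard] at h
    have h1 : (p + 1) * p * Nat.card (Sylow 2 G) = (p + 1) * p * (p + 2) := h.trans (by ring)
    exact Nat.eq_of_mul_eq_mul_left (by positivity) h1
  have hinj := hG.injective_toPermHom_sylow (p := 2) (by omega)
  have horder : ∀ x : G, x ≠ 1 → orderOf x = p ∨ orderOf x = q ∨ orderOf x = 2 := by
    intro x hx
    have h : orderOf x ∈ (Nat.card G).primeFactors := Nat.mem_primeFactors.mpr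
      ⟨hG.prime_orderOf x hx, orderOf_dvd_natCard x, Nat.card_pos.ne'⟩
    rw [hpqr] at h
    simpa using h
  have hqp2 : q ∣ p + 2 := by
    rw [← (hQ Q).1]
    exact Q.dvd_card_of_dvd_card hqG
  have hqfree : ∀ (x : G) (P : Sylow 2 G), orderOf x = q → x • P ≠ P := by
    intro x P hx hxP
    have h := orderOf_dvd_of_smul_eq hxP
    rw [hx, (hR P).1, (hR P).2, hq.dvd_mul] at h
    rcases h with h | h
    · have h1 : q ∣ 1 := by
        have := Nat.dvd_sub hqp2 h
        rwa [show p + 2 - (p + 1) = 1 by omega] at this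
      exact hq.not_dvd_one h1
    · have h1 : q ∣ 2 := (Nat.dvd_add_right h).mp hqp2
      exact hq2 ((Nat.prime_dvd_prime_iff_eq hq Nat.prime_two).mp h1)
  have hthree : ∀ (x : G) (a b c : Sylow 2 G), a ≠ b → a ≠ c → b ≠ c → x • a = a → x • b = b →
      x • c = c → x = 1 := by
    intro x a b c hab hac hbc ha hb hc
    by_contra hx
    rcases horder x hx with h | h | h
    · have hpg : IsPGroup p (Subgroup.zpowers x) :=
        IsPGroup.of_card (n := 1) (by rw [Nat.card_zpowers, h, pow_one])
      have hmod := hpg.card_modEq_card_fixedPoints (Sylow 2 G)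
      set F := MulAction.fixedPoints (Subgroup.zpowers x) (Sylow 2 G) with hF
      have hmem : ∀ P : Sylow 2 G, P ∈ F ↔ x • P = P := by
        intro P
        constructor
        · intro hP
          exact hP ⟨x, Subgroup.mem_zpowers x⟩
        · rintro hP ⟨y, hy⟩
          have h1 : Subgroup.zpowers x ≤ MulAction.stabilizer G P :=
            Subgroup.zpowers_le.mpr hP
          exact h1 hy
      have hF3 : 3 ≤ Nat.card F := by
        have h1 : ({a, b, c} : Set (Sylow 2 G)).ncard = 3 := Set.ncard_eq_three.mpr
          ⟨a, b, c, hab, hac, hbc, rfl⟩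
        rw [← h1, Nat.card_coe_set_eq]
        refine Set.ncard_le_ncard ?_ (Set.toFinite _)
        rintro P (rfl | rfl | rfl)
        · exact (hmem _).mpr ha
        · exact (hmem _).mpr hb
        · exact (hmem _).mpr hc
      rw [hX] at hmod
      have hFle : Nat.card F ≤ p + 2 := by
        rw [← hX]
        exact Finite.card_subtype_le _
      have hFeq : Nat.card F = p + 2 := by
        obtain ⟨k, hk⟩ := (Nat.modEq_iff_dvd' hFle).mp hmod.symm
        rcases Nat.eq_zero_or_pos k with rfl | hk0
        · omega
        · have := Nat.le_mul_of_pos_right p hk0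
          omega
      have hFuniv : F = Set.univ := by
        refine Set.eq_of_subset_of_ncard_le (Set.subset_univ F) ?_ (Set.toFinite _)
        rw [Set.ncard_univ, hX, ← Nat.card_coe_set_eq, hFeq]
      refine hx (hinj ?_)
      ext1 P
      rw [map_one]
      exact (hmem P).mp (hFuniv ▸ Set.mem_univ P)
    · exact hqfree x a h ha
    · exact hab (hG.eq_of_orderOf_eq_two_of_smul_eq h ha hb)
  have hq3 : q ≠ 3 := by
    rintro rfl
    obtain ⟨a⟩ : Nonempty (Sylow 2 G) := inferInstance
    let f : {x : G // orderOf x = 3} → {b : Sylow 2 G // b ≠ a} × {c : Sylow 2 G // c ≠ a} :=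
      fun x => ⟨⟨x.1 • a, hqfree _ a x.2⟩, ⟨x.1⁻¹ • a, hqfree _ a (by rw [orderOf_inv, x.2])⟩⟩
    have hf : Function.Injective f := by
      rintro ⟨x, hx⟩ ⟨y, hy⟩ hxy
      have h1 : x • a = y • a := congrArg (fun w => w.1.1) hxy
      have h2 : x⁻¹ • a = y⁻¹ • a := congrArg (fun w => w.2.1) hxy
      have hcube : ∀ z : G, orderOf z = 3 → z * z = z⁻¹ := by
        intro z hz
        have h := pow_orderOf_eq_one z
        rw [hz, pow_succ, pow_two] at h
        exact eq_inv_of_mul_eq_one_left h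
      have h3 : x • x • a = y • y • a := by
        rw [smul_smul, smul_smul, hcube x hx, hcube y hy, h2]
      have h4 : y⁻¹ * x = 1 := by
        refine hthree _ a (x • a) (x⁻¹ • a) (hqfree x a hx).symm
          (hqfree x⁻¹ a (by rw [orderOf_inv, hx])).symm ?_ ?_ ?_ ?_
        · intro h
          rw [← hcube x hx, mul_smul] at h
          exact hqfree x (x • a) hx h.symm
        · rw [mul_smul, h1, inv_smul_smul]
        · rw [mul_smul, h3, inv_smul_smul, h1]
        · rw [mul_smul, smul_inv_smul, h2]
      exact Subtype.ext (inv_mul_eq_one.mp h4).symm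
    have hle := Nat.card_le_card_of_injective f hf
    have hcompl : Nat.card {b : Sylow 2 G // b ≠ a} = p + 1 := by
      classical
      have := Fintype.ofFinite (Sylow 2 G)
      rw [Nat.card_eq_fintype_card, Fintype.card_subtype_compl, Fintype.card_subtype_eq,
        ← Nat.card_eq_fintype_card, hX]
      omega
    rw [Nat.card_prod, hcompl, hG.card_orderOf_eq Q, (hQ Q).2.2] at hle
    have hQcard := Q.card_mul_weylCard_mul_card
    rw [(hQ Q).1, (hQ Q).2.1, hcard] at hQcard
    have h5 : 2 * Nat.card (Sylow 3 G) = p * (p + 1) := by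
      refine Nat.eq_of_mul_eq_mul_left (show 0 < p + 2 by omega) ?_
      linarith
    rw [show p + 2 - 1 = p + 1 by omega] at hle
    have h6 := Nat.le_of_mul_le_mul_right hle (by omega)
    nlinarith
  have hp_eq : p = 3 := by
    have h3 : 3 ∣ p ∨ 3 ∣ p + 1 ∨ 3 ∣ p + 2 := by omega
    rcases h3 with h3 | h3 | h3
    · exact ((Nat.prime_dvd_prime_iff_eq Nat.prime_three hp).mp h3).symm
    · rw [← (hR R).1] at h3
      have := hRn.eq_of_prime_dvd_card Nat.prime_three h3
      omega
    · rw [← (hQ Q).1] at h3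
      have := hQn.eq_of_prime_dvd_card Nat.prime_three h3
      omega
  subst hp_eq
  let e : Sylow 2 G ≃ Fin 5 := Finite.equivFinOfCardEq hX
  let F : G →* Equiv.Perm (Fin 5) :=
    (e.permCongrHom : Equiv.Perm (Sylow 2 G) →* Equiv.Perm (Fin 5)).comp
      (MulAction.toPermHom G (Sylow 2 G))
  have hF : Function.Injective F := e.permCongrHom.injective.comp hinj
  have hrange : Nat.card F.range = 60 := by
    rw [← Nat.card_congr (MonoidHom.ofInjective hF).toEquiv, hcard]
  have hindex : F.range.index = 2 := by
    have h := Subgroup.card_mul_index F.range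
    rw [hrange, Nat.card_eq_fintype_card, Fintype.card_perm, Fintype.card_fin] at h
    have h120 : Nat.factorial 5 = 120 := rfl
    omega
  exact ⟨(MonoidHom.ofInjective hF).trans
    (MulEquiv.subgroupCongr (Equiv.Perm.eq_alternatingGroup_of_index_eq_two hindex))⟩

end HasPrimeOrderOrbits

/-- A finite group with at most 4 automorphism orbits is solvable or isomorphic
to `A₅`. -/
theorem stmt_17 (G : Type*) [Group G] [Finite G] (h : omegaAut G ≤ 4) :
    IsSolvable G ∨ Nonempty (G ≃* alternatingGroup (Fin 5)) := by
  by_cases hG : Group.IsSolvable G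
  · exact Or.inl hG
  · exact Or.inr (hasPrimeOrderOrbits_of_omegaAut_le_four h hG).nonempty_mulEquiv
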